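/- arXiv:q-alg/9710035 — 5 statements merged into one kernel-verified Lean document; each statement's English description precedes it below -/
import Mathlib

section
/- Let m₁ ≥ m₂ ≥ … ≥ m_l be integers, let i := #{p : m_p > 0} and let j be such that m_p < 0 exactly for j ≤ p ≤ l (so m_p = 0 for i < p < j). Set v := Ξ^{+,m₁}_1 ⋯ Ξ^{+,m_i}_i Ξ^{−,−m_j}_j ⋯ Ξ^{−,−m_l}_l |0⟩ ∈ F. Then: (a) Ê_{ab} v = 0 for all a, b ∈ ℤ with a < b; (b) ê*^{pq} v = 0 for all 1 ≤ p < q ≤ l; (c) Ê_{kk} v = #{p : m_p ≥ k}·v for every k ≥ 1, and Ê_{kk} v = −#{p : m_p ≤ k−1}·v for every k ≤ 0; (d) ê*^{pp} v = m_p·v for all 1 ≤ p ≤ l. -/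
/-!
Fermionic Fock space of `l` pairs of fermionic fields indexed by `½ + ℤ`.

The Fock space `FFock l` is the exterior algebra on the vector space `FV l` with basis
`v^{ε,p}_{-r}` for `ε ∈ {+,-}` (encoded as `Bool`, `true = +`), `1 ≤ p ≤ l`
(encoded as `Fin l`) and `r ∈ ½ + ℤ`, `r > 0` (encoded as `n : ℕ` with `r = n + ½`).

For `r > 0`, `ψ^{ε,p}_{-r}` is left exterior multiplication by the basis vector
`v^{ε,p}_{-r}`, and `ψ^{ε,p}_{r}` is the unique odd derivation (i.e. the left
contraction) with `ψ^{ε,p}_{r}(v^{ε',q}_{-r'}) = δ_{ε',-ε} δ_{q,p} δ_{r',r}`.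

A general mode `ψ^{ε,p}_{k - ½}` is encoded by `fermion ε p k` for `k : ℤ`.
-/

noncomputable section

/-- Basis index: `(ε, p, n)` corresponds to `v^{ε,p}_{-(n+½)}`. -/
abbrev FBas (l : ℕ) := Bool × Fin l × ℕ

abbrev FV (l : ℕ) := FBas l →₀ ℂ

/-- The fermionic Fock space: the exterior algebra `Λ(V)`. -/
abbrev FFock (l : ℕ) := ExteriorAlgebra ℂ (FV l)

/-- The vacuum vector `|0⟩ = 1`. -/
def fvac (l : ℕ) : FFock l := 1

/-- Creation operator `ψ^{ε,p}_{-(n+½)}`: left exterior multiplication by `v^{ε,p}_{-(n+½)}`. -/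
def psiCr (l : ℕ) (ε : Bool) (p : Fin l) (n : ℕ) : FFock l → FFock l :=
  fun x => ExteriorAlgebra.ι ℂ (Finsupp.single (ε, p, n) (1 : ℂ)) * x

/-- Annihilation operator `ψ^{ε,p}_{n+½}`: the odd derivation (left contraction) dual to
`v^{-ε,p}_{-(n+½)}`. -/
def psiAn (l : ℕ) (ε : Bool) (p : Fin l) (n : ℕ) : FFock l → FFock l :=
  fun x => CliffordAlgebra.contractLeft (Q := (0 : QuadraticForm ℂ (FV l)))
    (Finsupp.lapply ((!ε, p, n) : FBas l)) x

/-- `fermion ε p k` is the mode `ψ^{ε,p}_{k-½}`, for `k : ℤ`. -/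
def fermion (l : ℕ) (ε : Bool) (p : Fin l) (k : ℤ) : FFock l → FFock l :=
  if k ≤ 0 then psiCr l ε p (-k).toNat else psiAn l ε p (k - 1).toNat

/-- Normal ordered product `:ψ^{ε₁,p₁}_{k₁-½} ψ^{ε₂,p₂}_{k₂-½}:`, which is
`-ψ₂ ψ₁` if `k₁ - ½ > 0 > k₂ - ½` and `ψ₁ ψ₂` otherwise. -/
def nPsi (l : ℕ) (ε₁ : Bool) (p₁ : Fin l) (k₁ : ℤ) (ε₂ : Bool) (p₂ : Fin l) (k₂ : ℤ) :
    FFock l → FFock l :=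
  if 1 ≤ k₁ ∧ k₂ ≤ 0 then fun x => -(fermion l ε₂ p₂ k₂ (fermion l ε₁ p₁ k₁ x))
  else fun x => fermion l ε₁ p₁ k₁ (fermion l ε₂ p₂ k₂ x)

/-- `Ê_{ij} = Σ_{p=1}^{l} :ψ^{+,p}_{½-i} ψ^{-,p}_{j-½}:` (note `½ - i = (1-i) - ½`). -/
def Ehat (l : ℕ) (i j : ℤ) : FFock l → FFock l :=
  fun x => ∑ p : Fin l, nPsi l true p (1 - i) false p j x

/-- `ê*^{pq} = Σ_{r ∈ ½+ℤ} :ψ^{+,p}_{-r} ψ^{-,q}_{r}:`, parametrizing `r = k - ½`, `k : ℤ`;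
only finitely many summands act nonzero on a given vector, so the sum (`∑ᶠ`) is well defined. -/
def estar (l : ℕ) (p q : Fin l) : FFock l → FFock l :=
  fun x => ∑ᶠ k : ℤ, nPsi l true p (1 - k) false q k x

/-- `ê^{pq} = Σ_{r ∈ ½+ℤ} :ψ^{-,p}_{-r} ψ^{-,q}_{r}:`. -/
def ee (l : ℕ) (p q : Fin l) : FFock l → FFock l :=
  fun x => ∑ᶠ k : ℤ, nPsi l false p (1 - k) false q k x

/-- `ê**^{pq} = Σ_{r ∈ ½+ℤ} :ψ^{+,p}_{-r} ψ^{+,q}_{r}:`. -/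
def estarstar (l : ℕ) (p q : Fin l) : FFock l → FFock l :=
  fun x => ∑ᶠ k : ℤ, nPsi l true p (1 - k) true q k x

/-- `Ξ^{ε,m}_p = ψ^{ε,p}_{-m+½} ⋯ ψ^{ε,p}_{-3/2} ψ^{ε,p}_{-½}` (a product of `m` creation
operators; `Ξ^{ε,0}_p = 1`). -/
def Xi (l : ℕ) (ε : Bool) (p : Fin l) : ℕ → FFock l → FFock l
  | 0 => id
  | m + 1 => fun x => psiCr l ε p m (Xi l ε p m x)

/-- Left exterior multiplication by a basis vector. -/
def wedge {l : ℕ} (e : FBas l) (x : FFock l) : FFock l :=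
  ExteriorAlgebra.ι ℂ (Finsupp.single e (1 : ℂ)) * x

/-- Left contraction with the coordinate functional of a basis vector. -/
def contract {l : ℕ} (e : FBas l) (x : FFock l) : FFock l :=
  CliffordAlgebra.contractLeft (Q := (0 : QuadraticForm ℂ (FV l))) (Finsupp.lapply e) x

section Oscillators

variable {l : ℕ}

lemma wedge_zero (e : FBas l) : wedge e 0 = 0 := mul_zero _

lemma contract_zero (e : FBas l) : contract e 0 = 0 := map_zero _

lemma wedge_wedge_self (e : FBas l) (x : FFock l) : wedge e (wedge e x) = 0 := by
  simp [wedge, ← mul_assoc]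

lemma wedge_comm (e f : FBas l) (x : FFock l) :
    wedge e (wedge f x) = -wedge f (wedge e x) := by
  unfold wedge
  rw [← mul_assoc, ← mul_assoc, ← neg_mul, eq_neg_of_add_eq_zero_left
    (ExteriorAlgebra.ι_add_mul_swap (R := ℂ) (Finsupp.single e 1) (Finsupp.single f 1))]

lemma contract_wedge (e f : FBas l) (x : FFock l) :
    contract e (wedge f x) = (Finsupp.single f (1 : ℂ) e) • x - wedge f (contract e x) :=
  CliffordAlgebra.contractLeft_ι_mul (Q := (0 : QuadraticForm ℂ (FV l)))
    (Finsupp.lapply e) (Finsupp.single f 1) x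

lemma contract_wedge_self (e : FBas l) (x : FFock l) :
    contract e (wedge e x) = x - wedge e (contract e x) := by
  rw [contract_wedge, Finsupp.single_eq_same, one_smul]

lemma contract_wedge_of_ne {e f : FBas l} (h : e ≠ f) (x : FFock l) :
    contract e (wedge f x) = -wedge f (contract e x) := by
  rw [contract_wedge, Finsupp.single_eq_of_ne h, zero_smul, zero_sub]

lemma contract_comm (e f : FBas l) (x : FFock l) :
    contract e (contract f x) = -contract f (contract e x) :=
  CliffordAlgebra.contractLeft_comm (Q := (0 : QuadraticForm ℂ (FV l))) _ _ x

/-- `x` is killed by creation at every index in `O` and by annihilation at every other index. -/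
def IsOccupied (O : Set (FBas l)) (x : FFock l) : Prop :=
  (∀ e ∈ O, wedge e x = 0) ∧ ∀ e ∉ O, contract e x = 0

lemma isOccupied_fvac : IsOccupied (∅ : Set (FBas l)) (fvac l) :=
  ⟨fun _ h => h.elim, fun _ _ => CliffordAlgebra.contractLeft_one _ _⟩

lemma IsOccupied.insert {O : Set (FBas l)} {x : FFock l} (h : IsOccupied O x) (e : FBas l) :
    IsOccupied (Insert.insert e O) (wedge e x) := by
  refine ⟨fun f hf => ?_, fun f hf => ?_⟩
  · rcases hf with rfl | hf
    · exact wedge_wedge_self _ _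
    · rw [wedge_comm, h.1 f hf, wedge_zero, neg_zero]
  · rw [Set.mem_insert_iff, not_or] at hf
    rw [contract_wedge_of_ne hf.1, h.2 f hf.2, wedge_zero, neg_zero]

lemma IsOccupied.xi {O : Set (FBas l)} {x : FFock l} (h : IsOccupied O x) (ε : Bool) (p : Fin l)
    (k : ℕ) : IsOccupied ({e | e.1 = ε ∧ e.2.1 = p ∧ e.2.2 < k} ∪ O) (Xi l ε p k x) := by
  induction k with
  | zero => simpa [Xi] using h
  | succ k ih =>
    convert ih.insert (ε, p, k) using 1
    · ext ⟨ε', p', n⟩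
      simp only [Set.mem_union, Set.mem_ofPred_eq, Set.mem_insert_iff, Prod.mk.injEq]
      grind
    · rfl

lemma IsOccupied.wedge_contract {O : Set (FBas l)} {x : FFock l} (h : IsOccupied O x)
    {e : FBas l} (he : e ∈ O) : wedge e (contract e x) = x := by
  have := contract_wedge_self e x
  rw [h.1 e he, contract_zero] at this
  exact (sub_eq_zero.mp this.symm).symm

lemma IsOccupied.wedge_contract_eq_zero {O : Set (FBas l)} {x : FFock l} (h : IsOccupied O x)
    {e f : FBas l} (hef : e ≠ f) (hO : f ∈ O → e ∈ O) :
    wedge e (contract f x) = 0 := by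
  by_cases hf : f ∈ O
  · rw [← neg_eq_zero, ← contract_wedge_of_ne hef.symm, h.1 e (hO hf), contract_zero]
  · rw [h.2 f hf, wedge_zero]

lemma IsOccupied.contract_contract {O : Set (FBas l)} {x : FFock l} (h : IsOccupied O x)
    {e f : FBas l} (hO : e ∉ O ∨ f ∉ O) : contract e (contract f x) = 0 := by
  rcases hO with he | hf
  · rw [contract_comm, h.2 e he, contract_zero, neg_zero]
  · rw [h.2 f hf, contract_zero]

/-- The indices filled in the component `p` up to charge `m p`. -/
def filled (m : Fin l → ℤ) : Set (FBas l) :=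
  {e | (e.2.2 : ℤ) < if e.1 then m e.2.1 else -m e.2.1}

lemma isOccupied_foldr (m : Fin l → ℤ) (L : List (Fin l)) :
    IsOccupied {e | e ∈ filled m ∧ e.2.1 ∈ L} (L.foldr
      (fun p acc =>
        if 0 < m p then Xi l true p (m p).toNat acc
        else if m p < 0 then Xi l false p (-(m p)).toNat acc
        else acc)
      (fvac l)) := by
  induction L with
  | nil => simpa using isOccupied_fvac (l := l)
  | cons p L ih =>
    rw [List.foldr_cons]
    split_ifs with h₁ h₂
    · convert ih.xi true p (m p).toNat using 1
      ext ⟨ε, q, n⟩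
      simp only [filled, Set.mem_union, Set.mem_ofPred_eq, List.mem_cons]
      grind
    · convert ih.xi false p (-(m p)).toNat using 1
      ext ⟨ε, q, n⟩
      simp only [filled, Set.mem_union, Set.mem_ofPred_eq, List.mem_cons]
      grind
    · convert ih using 1
      ext ⟨ε, q, n⟩
      simp only [filled, Set.mem_ofPred_eq, List.mem_cons]
      grind

lemma nPsi_of_pos_of_pos {a b : ℤ} (ha : 1 ≤ a) (hb : 1 ≤ b) (p q : Fin l) (x : FFock l) :
    nPsi l true p (1 - a) false q b x =
      wedge (true, p, (a - 1).toNat) (contract (true, q, (b - 1).toNat) x) := by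
  simp only [nPsi, fermion, if_neg (show ¬(1 ≤ 1 - a ∧ b ≤ 0) by omega),
    if_pos (show 1 - a ≤ 0 by omega), if_neg (show ¬b ≤ 0 by omega),
    show -(1 - a) = a - 1 by ring]
  rfl

lemma nPsi_of_nonpos_of_pos {a b : ℤ} (ha : a ≤ 0) (hb : 1 ≤ b) (p q : Fin l) (x : FFock l) :
    nPsi l true p (1 - a) false q b x =
      contract (false, p, (-a).toNat) (contract (true, q, (b - 1).toNat) x) := by
  simp only [nPsi, fermion, if_neg (show ¬(1 ≤ 1 - a ∧ b ≤ 0) by omega),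
    if_neg (show ¬1 - a ≤ 0 by omega), if_neg (show ¬b ≤ 0 by omega),
    show 1 - a - 1 = -a by ring]
  rfl

lemma nPsi_of_nonpos_of_nonpos {a b : ℤ} (ha : a ≤ 0) (hb : b ≤ 0) (p q : Fin l) (x : FFock l) :
    nPsi l true p (1 - a) false q b x =
      -wedge (false, q, (-b).toNat) (contract (false, p, (-a).toNat) x) := by
  simp only [nPsi, fermion, if_pos (show 1 ≤ 1 - a ∧ b ≤ 0 by omega),
    if_neg (show ¬1 - a ≤ 0 by omega), if_pos hb, show 1 - a - 1 = -a by ring]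
  rfl

variable {m : Fin l → ℤ} {v : FFock l}

lemma nPsi_of_lt (hv : IsOccupied (filled m) v) {a b : ℤ} (hab : a < b) (p : Fin l) :
    nPsi l true p (1 - a) false p b v = 0 := by
  rcases le_or_gt b 0 with hb | hb
  · rw [nPsi_of_nonpos_of_nonpos (by omega) hb, neg_eq_zero]
    refine hv.wedge_contract_eq_zero ?_ ?_
    · simp only [ne_eq, Prod.mk.injEq]
      omega
    · simp only [filled, Set.mem_ofPred_eq]
      grind
  rcases le_or_gt a 0 with ha | ha
  · rw [nPsi_of_nonpos_of_pos ha hb]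
    refine hv.contract_contract ?_
    simp only [filled, Set.mem_ofPred_eq]
    grind
  · rw [nPsi_of_pos_of_pos ha hb]
    refine hv.wedge_contract_eq_zero ?_ ?_
    · simp only [ne_eq, Prod.mk.injEq]
      omega
    · simp only [filled, Set.mem_ofPred_eq]
      grind

lemma nPsi_of_component_ne (hv : IsOccupied (filled m) v) {p q : Fin l} (hpq : p ≠ q)
    (hm : m q ≤ m p) (k : ℤ) : nPsi l true p (1 - k) false q k v = 0 := by
  rcases le_or_gt k 0 with hk | hk
  · rw [nPsi_of_nonpos_of_nonpos hk hk, neg_eq_zero]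
    refine hv.wedge_contract_eq_zero (by simp [hpq.symm]) ?_
    simp only [filled, Set.mem_ofPred_eq]
    grind
  · rw [nPsi_of_pos_of_pos hk hk]
    refine hv.wedge_contract_eq_zero (by simp [hpq]) ?_
    simp only [filled, Set.mem_ofPred_eq]
    grind

lemma nPsi_diag_of_pos (hv : IsOccupied (filled m) v) {k : ℤ} (hk : 1 ≤ k) (p : Fin l) :
    nPsi l true p (1 - k) false p k v = if k ≤ m p then v else 0 := by
  rw [nPsi_of_pos_of_pos hk hk]
  split_ifs with h
  · refine hv.wedge_contract ?_
    simp only [filled, Set.mem_ofPred_eq]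
    grind
  · rw [hv.2, wedge_zero]
    simp only [filled, Set.mem_ofPred_eq]
    grind

lemma nPsi_diag_of_nonpos (hv : IsOccupied (filled m) v) {k : ℤ} (hk : k ≤ 0) (p : Fin l) :
    nPsi l true p (1 - k) false p k v = if m p ≤ k - 1 then -v else 0 := by
  rw [nPsi_of_nonpos_of_nonpos hk hk]
  split_ifs with h
  · rw [hv.wedge_contract]
    simp only [filled, Set.mem_ofPred_eq]
    grind
  · rw [hv.2, wedge_zero, neg_zero]
    simp only [filled, Set.mem_ofPred_eq]
    grind

lemma nPsi_diag (hv : IsOccupied (filled m) v) (k : ℤ) (p : Fin l) :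
    nPsi l true p (1 - k) false p k v =
      (if k ∈ Finset.Ioc 0 (m p) then v else 0) - if k ∈ Finset.Ioc (m p) 0 then v else 0 := by
  simp only [Finset.mem_Ioc]
  rcases le_or_gt k 0 with hk | hk
  · rw [nPsi_diag_of_nonpos hv hk]
    grind
  · rw [nPsi_diag_of_pos hv hk]
    grind

lemma estar_self (hv : IsOccupied (filled m) v) (p : Fin l) :
    estar l p p v = (m p : ℂ) • v := by
  have hsupp : (Function.support fun k : ℤ => nPsi l true p (1 - k) false p k v) ⊆
      ↑(Finset.Ioc 0 (m p) ∪ Finset.Ioc (m p) 0) := by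
    intro k hk
    by_contra h
    rw [Finset.mem_coe, Finset.mem_union, not_or] at h
    exact hk (by simp only [nPsi_diag hv, if_neg h.1, if_neg h.2, sub_zero])
  rw [estar, finsum_eq_sum_of_support_subset _ hsupp]
  simp only [nPsi_diag hv]
  rw [Finset.sum_sub_distrib, Finset.sum_ite_mem, Finset.sum_ite_mem,
    Finset.inter_eq_right.mpr Finset.subset_union_left,
    Finset.inter_eq_right.mpr Finset.subset_union_right, Finset.sum_const, Finset.sum_const,
    Int.card_Ioc, Int.card_Ioc, ← natCast_zsmul, ← natCast_zsmul, ← sub_smul,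
    show (((m p - 0).toNat : ℕ) : ℤ) - ((0 - m p).toNat : ℕ) = m p by omega, Int.cast_smul_eq_zsmul]

end Oscillators

/-- with `m₁ ≥ … ≥ m_l` integers, `i = #{p : m_p > 0}` and `m_p < 0` exactly
for `j ≤ p ≤ l` (1-indexed), the vector
`v = Ξ^{+,m₁}_1 ⋯ Ξ^{+,m_i}_i Ξ^{-,-m_j}_j ⋯ Ξ^{-,-m_l}_l |0⟩` is a highest weight vector
for `GL(l) × ĝl`: it is annihilated by all `Ê_{ab}` (`a < b`) and all `ê*^{pq}` (`p < q`),
and it is an eigenvector of the `Ê_{kk}` and `ê*^{pp}` with the indicated eigenvalues. -/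
theorem hwvector_GL_glhat (l : ℕ) (hl : 1 ≤ l) (m : Fin l → ℤ)
    (hm : ∀ p q : Fin l, p ≤ q → m q ≤ m p)
    (i j : ℕ)
    (hi : ∀ p : Fin l, 0 < m p ↔ (p : ℕ) + 1 ≤ i)
    (hj : ∀ p : Fin l, m p < 0 ↔ j ≤ (p : ℕ) + 1)
    (v : FFock l)
    (hv : v = (List.finRange l).foldr
      (fun p acc =>
        if 0 < m p then Xi l true p (m p).toNat acc
        else if m p < 0 then Xi l false p (-(m p)).toNat acc
        else acc)
      (fvac l)) :
    (∀ a b : ℤ, a < b → Ehat l a b v = 0) ∧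
    (∀ p q : Fin l, p < q → estar l p q v = 0) ∧
    (∀ k : ℤ, 1 ≤ k →
      Ehat l k k v = (((Finset.univ.filter (fun p : Fin l => k ≤ m p)).card : ℂ)) • v) ∧
    (∀ k : ℤ, k ≤ 0 →
      Ehat l k k v = -(((Finset.univ.filter (fun p : Fin l => m p ≤ k - 1)).card : ℂ)) • v) ∧
    (∀ p : Fin l, estar l p p v = (m p : ℂ) • v) := by
  have hocc : IsOccupied (filled m) v := by
    rw [hv]
    convert isOccupied_foldr m (List.finRange l) using 1
    simp
  refine ⟨fun a b hab => ?_, fun p q hpq => ?_, fun k hk => ?_, fun k hk => ?_,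
    estar_self hocc⟩
  · exact Finset.sum_eq_zero fun p _ => nPsi_of_lt hocc hab p
  · exact (finsum_congr fun k => nPsi_of_component_ne hocc hpq.ne (hm p q hpq.le) k).trans
      finsum_zero
  · simp only [Ehat, nPsi_diag_of_pos hocc hk]
    rw [← Finset.sum_filter, Finset.sum_const, Nat.cast_smul_eq_nsmul]
  · simp only [Ehat, nPsi_diag_of_nonpos hocc hk]
    rw [← Finset.sum_filter, Finset.sum_const, neg_smul, Nat.cast_smul_eq_nsmul, smul_neg]

end
end

section
/- Let m₁ ≥ m₂ ≥ … ≥ m_l > 0 be integers. Set v⁺ := Ξ^{+,m₁}_1 ⋯ Ξ^{+,m_{l−1}}_{l−1} Ξ^{+,m_l}_l |0⟩ and v⁻ := Ξ^{+,m₁}_1 ⋯ Ξ^{+,m_{l−1}}_{l−1} Ξ^{−,m_l}_l |0⟩ in F. Then each of v⁺ and v⁻ satisfies: Ê_{ab} v = 0 for all a < b; ê*^{pq} v = 0 for all p < q; and ê**^{pq} v = 0 for all p ≠ q. Moreover ê*^{pp} v⁺ = m_p·v⁺ for all p, while ê*^{pp} v⁻ = m_p·v⁻ for p < l and ê*^{ll}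 v⁻ = −m_l·v⁻. -/
/-!
Fermionic Fock space of `l` pairs of fermionic fields indexed by `½ + ℤ`.

The Fock space `FFock l` is the exterior algebra on the vector space `FV l` with basis
`v^{ε,p}_{-r}` for `ε ∈ {+,-}` (encoded as `Bool`, `true = +`), `1 ≤ p ≤ l`
(encoded as `Fin l`) and `r ∈ ½ + ℤ`, `r > 0` (encoded as `n : ℕ` with `r = n + ½`).

For `r > 0`, `ψ^{ε,p}_{-r}` is left exterior multiplication by the basis vector
`v^{ε,p}_{-r}`, and `ψ^{ε,p}_{r}` is the unique odd derivation (i.e. the left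
contraction) with `ψ^{ε,p}_{r}(v^{ε',q}_{-r'}) = δ_{ε',-ε} δ_{q,p} δ_{r',r}`.

A general mode `ψ^{ε,p}_{k - ½}` is encoded by `fermion ε p k` for `k : ℤ`.
-/

noncomputable section

theorem psiCr_psiCr (l : ℕ) (ε ε' : Bool) (p p' : Fin l) (n n' : ℕ) (x : FFock l) :
    psiCr l ε p n (psiCr l ε' p' n' x) = -psiCr l ε' p' n' (psiCr l ε p n x) := by
  simp only [psiCr, ← mul_assoc]
  rw [eq_neg_of_add_eq_zero_left (ExteriorAlgebra.ι_add_mul_swap _ _), neg_mul]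

theorem psiAn_psiAn (l : ℕ) (ε ε' : Bool) (p p' : Fin l) (n n' : ℕ) (x : FFock l) :
    psiAn l ε p n (psiAn l ε' p' n' x) = -psiAn l ε' p' n' (psiAn l ε p n x) :=
  CliffordAlgebra.contractLeft_comm _ _ _

theorem psiAn_psiCr (l : ℕ) (ε ε' : Bool) (p p' : Fin l) (n n' : ℕ) (x : FFock l) :
    psiAn l ε p n (psiCr l ε' p' n' x) =
      (if (ε', p', n') = ((!ε, p, n) : FBas l) then x else 0)
        - psiCr l ε' p' n' (psiAn l ε p n x) := by
  simp only [psiCr, psiAn]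
  refine (CliffordAlgebra.contractLeft_ι_mul _ _ _).trans ?_
  congr 1
  rw [Finsupp.lapply_apply, Finsupp.single_apply]
  split_ifs <;> simp

@[simp]
theorem fermion_zero (l : ℕ) (ε : Bool) (p : Fin l) (k : ℤ) : fermion l ε p k 0 = 0 := by
  unfold fermion
  split_ifs <;> simp [psiCr, psiAn]

/-- The canonical anticommutation relations for the modes `ψ^{ε,p}_{k-½}`. -/
theorem fermion_anticomm (l : ℕ) (ε ε' : Bool) (p p' : Fin l) (k k' : ℤ) (x : FFock l) :
    fermion l ε p k (fermion l ε' p' k' x) =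
      (if ε' = !ε ∧ p' = p ∧ k + k' = 1 then x else 0)
        - fermion l ε' p' k' (fermion l ε p k x) := by
  unfold fermion
  by_cases hk : k ≤ 0 <;> by_cases hk' : k' ≤ 0
  · rw [if_pos hk, if_pos hk', if_neg (by omega), zero_sub, psiCr_psiCr]
  · rw [if_pos hk, if_neg hk', psiAn_psiCr, ← sub_add, eq_comm, add_eq_right, sub_eq_zero]
    refine if_congr ?_ rfl rfl
    rw [Prod.mk.injEq, Prod.mk.injEq, eq_comm (a := p)]
    refine and_congr (by cases ε <;> cases ε' <;> decide) (and_congr_right' ?_)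
    omega
  · rw [if_neg hk, if_pos hk', psiAn_psiCr]
    congr 1
    refine if_congr ?_ rfl rfl
    rw [Prod.mk.injEq, Prod.mk.injEq]
    refine and_congr_right' (and_congr_right' ?_)
    omega
  · rw [if_neg hk, if_neg hk', if_neg (by omega), zero_sub, psiAn_psiAn]

/-- `x` behaves like a monomial whose occupied states are exactly those in `S`. -/
structure IsOccupied_s11 (l : ℕ) (S : Set (FBas l)) (x : FFock l) : Prop where
  psiCr_eq_zero : ∀ ε p n, (ε, p, n) ∈ S → psiCr l ε p n x = 0
  psiAn_eq_zero : ∀ ε p n, (!ε, p, n) ∉ S → psiAn l ε p n x = 0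

theorem isOccupied_fvac_s11 (l : ℕ) : IsOccupied_s11 l ∅ (fvac l) where
  psiCr_eq_zero _ _ _ h := h.elim
  psiAn_eq_zero _ _ _ _ := CliffordAlgebra.contractLeft_one (Q := 0) _

theorem IsOccupied_s11.create {l : ℕ} {S : Set (FBas l)} {x : FFock l} (h : IsOccupied_s11 l S x)
    (ε : Bool) (p : Fin l) (n : ℕ) :
    IsOccupied_s11 l (insert (ε, p, n) S) (psiCr l ε p n x) where
  psiCr_eq_zero ε' p' n' hmem := by
    rcases hmem with heq | hmem
    · obtain ⟨rfl, rfl, rfl⟩ : ε' = ε ∧ p' = p ∧ n' = n := by simpa using heq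
      simp [psiCr, ← mul_assoc]
    · rw [psiCr_psiCr, h.psiCr_eq_zero _ _ _ hmem]
      simp [psiCr]
  psiAn_eq_zero ε' p' n' hmem := by
    rw [Set.mem_insert_iff, not_or] at hmem
    rw [psiAn_psiCr, h.psiAn_eq_zero _ _ _ hmem.2, if_neg (Ne.symm hmem.1)]
    simp [psiCr]

theorem IsOccupied_s11.apply_Xi {l : ℕ} {S : Set (FBas l)} {x : FFock l} (h : IsOccupied_s11 l S x)
    (ε : Bool) (p : Fin l) (m : ℕ) :
    IsOccupied_s11 l ({b | b.1 = ε ∧ b.2.1 = p ∧ b.2.2 < m} ∪ S) (Xi l ε p m x) := by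
  induction m with
  | zero => simpa [Xi] using h
  | succ m ih =>
    change IsOccupied_s11 l _ (psiCr l ε p m (Xi l ε p m x))
    convert ih.create ε p m using 1
    ext ⟨ε', p', n'⟩
    simp only [Set.mem_union, Set.mem_ofPred_eq, Set.mem_insert_iff, Prod.mk.injEq,
      Nat.lt_succ_iff_lt_or_eq]
    tauto

theorem isOccupied_foldr_Xi (l : ℕ) (s : Fin l → Bool) (m : Fin l → ℕ) (L : List (Fin l)) :
    IsOccupied_s11 l {b | b.2.1 ∈ L ∧ b.1 = s b.2.1 ∧ b.2.2 < m b.2.1}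
      (L.foldr (fun p acc => Xi l (s p) p (m p) acc) (fvac l)) := by
  induction L with
  | nil => simpa using isOccupied_fvac_s11 l
  | cons p L ih =>
    rw [List.foldr_cons]
    convert ih.apply_Xi (s p) p (m p) using 1
    ext ⟨ε', p', n'⟩
    simp only [Set.mem_union, Set.mem_ofPred_eq, List.mem_cons]
    constructor
    · rintro ⟨rfl | h, h'⟩
      · exact Or.inl ⟨h'.1, rfl, h'.2⟩
      · exact Or.inr ⟨h, h'⟩
    · rintro (⟨h, rfl, h'⟩ | h)
      · exact ⟨Or.inl rfl, h, h'⟩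
      · exact ⟨Or.inr h.1, h.2⟩

/-- The mode threshold of the state in which the `m p` lowest modes of species `(s p, p)` are
filled: `ψ^{ε,p}_{k-½}` annihilates it as soon as `k` exceeds `modeThreshold s m ε p`. -/
def modeThreshold {l : ℕ} (s : Fin l → Bool) (m : Fin l → ℤ) (ε : Bool) (p : Fin l) : ℤ :=
  if ε = s p then -m p else m p

/-- `x` is annihilated by every mode above the threshold. -/
def IsFilled (l : ℕ) (s : Fin l → Bool) (m : Fin l → ℤ) (x : FFock l) : Prop :=
  ∀ ε p k, modeThreshold s m ε p < k → fermion l ε p k x = 0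

theorem isFilled_foldr_Xi (l : ℕ) (s : Fin l → Bool) (m : Fin l → ℤ) (hpos : ∀ p, 0 < m p) :
    IsFilled l s m
      ((List.finRange l).foldr (fun p acc => Xi l (s p) p (m p).toNat acc) (fvac l)) := by
  intro ε p k hk
  have h := isOccupied_foldr_Xi l s (fun p => (m p).toNat) (List.finRange l)
  have hp := hpos p
  unfold modeThreshold at hk
  unfold fermion
  by_cases h₁ : ε = s p <;> by_cases h₂ : k ≤ 0 <;> simp only [h₁, h₂, if_true, if_false] at hk ⊢
  · refine h.psiCr_eq_zero _ _ _ ⟨List.mem_finRange _, rfl, ?_⟩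
    dsimp only
    omega
  · refine h.psiAn_eq_zero _ _ _ fun hmem => ?_
    simpa using hmem.2.1
  · omega
  · refine h.psiAn_eq_zero _ _ _ fun hmem => ?_
    have := hmem.2.2
    dsimp only at this
    omega

theorem nPsi_apply (l : ℕ) (ε ε' : Bool) (p p' : Fin l) (k k' : ℤ) (x : FFock l) :
    nPsi l ε p k ε' p' k' x =
      if 1 ≤ k ∧ k' ≤ 0 then -fermion l ε' p' k' (fermion l ε p k x)
      else fermion l ε p k (fermion l ε' p' k' x) := by
  unfold nPsi
  split_ifs <;> rfl

/-- A normally ordered product of two anticommuting modes annihilates a filled state if one of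
them lies above the threshold. -/
theorem IsFilled.nPsi_eq_zero {l : ℕ} {s : Fin l → Bool} {m : Fin l → ℤ} {x : FFock l}
    (h : IsFilled l s m x) {ε ε' : Bool} {p p' : Fin l} {k k' : ℤ}
    (hac : ¬(ε' = !ε ∧ p' = p ∧ k + k' = 1))
    (hk : modeThreshold s m ε p + modeThreshold s m ε' p' < k + k') :
    nPsi l ε p k ε' p' k' x = 0 := by
  have hswap := fermion_anticomm l ε ε' p p' k k' x
  rw [if_neg hac, zero_sub] at hswap
  have hz : fermion l ε p k (fermion l ε' p' k' x) = 0 := by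
    by_cases h₁ : modeThreshold s m ε' p' < k'
    · rw [h _ _ _ h₁, fermion_zero]
    · rw [hswap, h ε p k (by omega), fermion_zero, neg_zero]
  rw [nPsi_apply]
  split_ifs
  · rw [← hswap, hz]
  · exact hz

theorem modeThreshold_true_add_false {l : ℕ} (s : Fin l → Bool) (m : Fin l → ℤ) (p : Fin l) :
    modeThreshold s m true p + modeThreshold s m false p = 0 := by
  unfold modeThreshold
  cases s p <;> simp

theorem IsFilled.Ehat_eq_zero {l : ℕ} {s : Fin l → Bool} {m : Fin l → ℤ} {x : FFock l}
    (h : IsFilled l s m x) {a b : ℤ} (hab : a < b) : Ehat l a b x = 0 := by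
  refine Finset.sum_eq_zero fun p _ => h.nPsi_eq_zero (by omega) ?_
  rw [modeThreshold_true_add_false]
  omega

theorem IsFilled.estar_eq_zero {l : ℕ} {s : Fin l → Bool} {m : Fin l → ℤ} {x : FFock l}
    (h : IsFilled l s m x) {p q : Fin l} (hpq : p ≠ q)
    (hk : modeThreshold s m true p + modeThreshold s m false q ≤ 0) : estar l p q x = 0 := by
  refine finsum_eq_zero_of_forall_eq_zero fun k => h.nPsi_eq_zero ?_ (by omega)
  exact fun hc => hpq hc.2.1.symm

theorem IsFilled.estarstar_eq_zero {l : ℕ} {s : Fin l → Bool} {m : Fin l → ℤ} {x : FFock l}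
    (h : IsFilled l s m x) {p q : Fin l}
    (hk : modeThreshold s m true p + modeThreshold s m true q ≤ 0) : estarstar l p q x = 0 := by
  refine finsum_eq_zero_of_forall_eq_zero fun k => h.nPsi_eq_zero ?_ (by omega)
  simp

theorem finsum_ite_Ioc {M : Type*} [AddCommGroup M] [Module ℂ M] (a b : ℤ) (hab : a ≤ b) (x : M) :
    ∑ᶠ k : ℤ, (if a < k ∧ k ≤ b then x else 0) = ((b - a : ℤ) : ℂ) • x := by
  rw [finsum_eq_finsetSum_of_support_subset (s := Finset.Ioc a b)]
  · rw [Finset.sum_congr rfl fun k hk => if_pos (Finset.mem_Ioc.1 hk), Finset.sum_const,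
      Int.card_Ioc, ← Nat.cast_smul_eq_nsmul ℂ, ← Int.cast_natCast,
      Int.toNat_of_nonneg (by omega)]
  · intro k hk
    rw [Finset.coe_Ioc, Set.mem_Ioc]
    by_contra hc
    exact hk (if_neg hc)

theorem IsFilled.estar_self_of_true {l : ℕ} {s : Fin l → Bool} {m : Fin l → ℤ} {x : FFock l}
    (h : IsFilled l s m x) {p : Fin l} (hs : s p = true) (hp : 0 < m p) :
    estar l p p x = (m p : ℂ) • x := by
  have ht : modeThreshold s m true p = -m p := by simp [modeThreshold, hs]
  have hf : modeThreshold s m false p = m p := by simp [modeThreshold, hs]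
  have key (k : ℤ) : nPsi l true p (1 - k) false p k x = if 0 < k ∧ k ≤ m p then x else 0 := by
    rw [nPsi_apply]
    split_ifs with h₁ h₂ h₂
    · omega
    · rw [h true p (1 - k) (by omega), fermion_zero, neg_zero]
    · rw [fermion_anticomm, if_pos (by simp), h true p (1 - k) (by omega), fermion_zero, sub_zero]
    · rw [h false p k (by omega), fermion_zero]
  simp only [estar, key]
  rw [finsum_ite_Ioc _ _ hp.le, sub_zero]

theorem IsFilled.estar_self_of_false {l : ℕ} {s : Fin l → Bool} {m : Fin l → ℤ} {x : FFock l}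
    (h : IsFilled l s m x) {p : Fin l} (hs : s p = false) (hp : 0 < m p) :
    estar l p p x = -(m p : ℂ) • x := by
  have ht : modeThreshold s m true p = m p := by simp [modeThreshold, hs]
  have hf : modeThreshold s m false p = -m p := by simp [modeThreshold, hs]
  have key (k : ℤ) : nPsi l true p (1 - k) false p k x =
      if -m p < k ∧ k ≤ 0 then -x else 0 := by
    rw [nPsi_apply]
    split_ifs with h₁ h₂ h₂
    · rw [fermion_anticomm, if_pos (by simp), h false p k (by omega), fermion_zero, sub_zero]
    · rw [h true p (1 - k) (by omega), fermion_zero, neg_zero]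
    · omega
    · rw [h false p k (by omega), fermion_zero]
  simp only [estar, key]
  rw [finsum_ite_Ioc _ _ (by omega), zero_sub, neg_neg, smul_neg, neg_smul]

/-- for integers `m₁ ≥ … ≥ m_l > 0`, each of
`v⁺ = Ξ^{+,m₁}_1 ⋯ Ξ^{+,m_{l-1}}_{l-1} Ξ^{+,m_l}_l |0⟩` and
`v⁻ = Ξ^{+,m₁}_1 ⋯ Ξ^{+,m_{l-1}}_{l-1} Ξ^{-,m_l}_l |0⟩` is annihilated by all `Ê_{ab}`
(`a < b`), all `ê*^{pq}` (`p < q`) and all `ê**^{pq}` (`p ≠ q`); moreover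
`ê*^{pp} v⁺ = m_p v⁺` for all `p`, while `ê*^{pp} v⁻ = m_p v⁻` for `p < l` and
`ê*^{ll} v⁻ = -m_l v⁻`. -/
theorem hwvectors_O2l_dinf (l : ℕ) (hl : 1 ≤ l) (m : Fin l → ℤ)
    (hm : ∀ p q : Fin l, p ≤ q → m q ≤ m p)
    (hpos : ∀ p : Fin l, 0 < m p)
    (vplus vminus : FFock l)
    (hvplus : vplus = (List.finRange l).foldr
      (fun p acc => Xi l true p (m p).toNat acc) (fvac l))
    (hvminus : vminus = (List.finRange l).foldr
      (fun (p : Fin l) acc =>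
        if (p : ℕ) + 1 = l then Xi l false p (m p).toNat acc
        else Xi l true p (m p).toNat acc)
      (fvac l)) :
    (∀ a b : ℤ, a < b → Ehat l a b vplus = 0 ∧ Ehat l a b vminus = 0) ∧
    (∀ p q : Fin l, p < q → estar l p q vplus = 0 ∧ estar l p q vminus = 0) ∧
    (∀ p q : Fin l, p ≠ q → estarstar l p q vplus = 0 ∧ estarstar l p q vminus = 0) ∧
    (∀ p : Fin l, estar l p p vplus = (m p : ℂ) • vplus) ∧
    (∀ p : Fin l, (p : ℕ) + 1 < l → estar l p p vminus = (m p : ℂ) • vminus) ∧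
    (∀ p : Fin l, (p : ℕ) + 1 = l → estar l p p vminus = -(m p : ℂ) • vminus) := by
  have hplus : IsFilled l (fun _ => true) m vplus := by
    subst hvplus
    exact isFilled_foldr_Xi l (fun _ => true) m hpos
  have hminus : IsFilled l (fun p => decide ((p : ℕ) + 1 ≠ l)) m vminus := by
    have hf := isFilled_foldr_Xi l (fun p => decide ((p : ℕ) + 1 ≠ l)) m hpos
    convert hf using 1
    rw [hvminus]
    congr 1
    funext p acc
    split_ifs with h <;> simp [h]
  refine ⟨fun a b hab => ⟨hplus.Ehat_eq_zero hab, hminus.Ehat_eq_zero hab⟩,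
    fun p q hpq => ⟨hplus.estar_eq_zero hpq.ne ?_, hminus.estar_eq_zero hpq.ne ?_⟩,
    fun p q hpq => ⟨hplus.estarstar_eq_zero ?_, hminus.estarstar_eq_zero ?_⟩,
    fun p => hplus.estar_self_of_true rfl (hpos p),
    fun p hp => hminus.estar_self_of_true (decide_eq_true hp.ne) (hpos p),
    fun p hp => hminus.estar_self_of_false (decide_eq_false (not_not_intro hp)) (hpos p)⟩
  · have := hm p q hpq.le
    simp only [modeThreshold, if_true, Bool.false_eq_true, if_false]
    omega
  · have := hm p q hpq.le
    have := hpos p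
    have := hpos q
    have := q.isLt
    rw [Fin.lt_def] at hpq
    have hp : (p : ℕ) + 1 ≠ l := by omega
    simp only [modeThreshold, decide_eq_true hp, if_true]
    split_ifs <;> omega
  · have := hpos p
    have := hpos q
    simp only [modeThreshold, if_true]
    omega
  · have := hpos p
    have := hpos q
    have := p.isLt
    have := q.isLt
    have hne := Fin.val_ne_of_ne hpq
    simp only [modeThreshold, eq_comm (a := true), decide_eq_true_eq]
    split_ifs with h₁ h₂ h₂
    · omega
    · have := hm p q (Fin.le_def.2 (by omega))
      omega
    · have := hm q p (Fin.le_def.2 (by omega))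
      omega
    · omega

end
end

section
/- (1) For every a ∈ gl and every x ∈ F, only finitely many terms of the sum Σ_{i,j∈ℤ} a_{ij} Ê_{ij} x are nonzero, so setting Ê(a)x := Σ_{i,j} a_{ij} Ê_{ij} x defines a linear map Ê : gl → End(F). (2) For all a, b ∈ gl one has [Ê(a), Ê(b)] = Ê(ab − ba) − l·C(a,b)·id_F; equivalently, the map a + λC ↦ Ê(a) − λ·l·id_F is a Lie algebra homomorphism from the central extension ĝl := gl ⊕ ℂC with bracket [a+λC, b+μC] = (ab−ba) + C(a,b)·C into End(F). In particular, [Ê_{ij}, Ê_{mn}] = δ_{jm} Ê_{in} − δ_{in} Ê_{mj} − l·δ_{jm} δ_{in} (χ(i≤0) − χ(j≤0))·id_F, where χ(i≤0) is 1 if i ≤ 0 and 0 otherwise. -/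
/-!
Bosonic Fock space of `l` pairs of bosonic ghost fields indexed by `½ + ℤ`.

The Fock space `BFock l` is the polynomial algebra `ℂ[x^{ε,p}_r]` with
`ε ∈ {+,-}` (encoded as `Bool`, `true = +`), `1 ≤ p ≤ l` (encoded as `Fin l`) and
`r ∈ ½+ℤ`, `r > 0` (encoded as `n : ℕ` with `r = n + ½`), with vacuum `|0⟩ = 1`.

For `r > 0`, `γ^{ε,p}_{-r}` is multiplication by `x^{ε,p}_r`, while
`γ^{+,p}_{r} = ∂/∂x^{-,p}_r` and `γ^{-,p}_{r} = -∂/∂x^{+,p}_r`.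
A general mode `γ^{ε,p}_{k-½}` is encoded by `boson ε p k` for `k : ℤ`.
-/

noncomputable section

/-- Variable index: `(ε, p, n)` corresponds to `x^{ε,p}_{n+½}`. -/
abbrev BBas (l : ℕ) := Bool × Fin l × ℕ

/-- The bosonic Fock space: the polynomial algebra on the variables `x^{ε,p}_r`. -/
abbrev BFock (l : ℕ) := MvPolynomial (BBas l) ℂ

/-- The vacuum vector `|0⟩ = 1`. -/
def bvac (l : ℕ) : BFock l := 1

/-- Creation operator `γ^{ε,p}_{-(n+½)}`: multiplication by `x^{ε,p}_{n+½}`. -/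
def gamCr (l : ℕ) (ε : Bool) (p : Fin l) (n : ℕ) : BFock l → BFock l :=
  fun f => MvPolynomial.X ((ε, p, n) : BBas l) * f

/-- Annihilation operator: `γ^{+,p}_{n+½} = ∂/∂x^{-,p}_{n+½}` and
`γ^{-,p}_{n+½} = -∂/∂x^{+,p}_{n+½}`. -/
def gamAn (l : ℕ) (ε : Bool) (p : Fin l) (n : ℕ) : BFock l → BFock l :=
  if ε then fun f => MvPolynomial.pderiv ((false, p, n) : BBas l) f
  else fun f => -(MvPolynomial.pderiv ((true, p, n) : BBas l) f)

/-- `boson ε p k` is the mode `γ^{ε,p}_{k-½}`, for `k : ℤ`. -/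
def boson (l : ℕ) (ε : Bool) (p : Fin l) (k : ℤ) : BFock l → BFock l :=
  if k ≤ 0 then gamCr l ε p (-k).toNat else gamAn l ε p (k - 1).toNat

/-- Normal ordered product `:γ^{ε₁,p₁}_{k₁-½} γ^{ε₂,p₂}_{k₂-½}:`, which is `γ₂ γ₁` if
`k₁ - ½ > 0 > k₂ - ½` and `γ₁ γ₂` otherwise. -/
def nGam (l : ℕ) (ε₁ : Bool) (p₁ : Fin l) (k₁ : ℤ) (ε₂ : Bool) (p₂ : Fin l) (k₂ : ℤ) :
    BFock l → BFock l :=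
  if 1 ≤ k₁ ∧ k₂ ≤ 0 then fun x => boson l ε₂ p₂ k₂ (boson l ε₁ p₁ k₁ x)
  else fun x => boson l ε₁ p₁ k₁ (boson l ε₂ p₂ k₂ x)

/-- `Ê_{ij} = -Σ_{p=1}^{l} :γ^{+,p}_{½-i} γ^{-,p}_{j-½}:`. -/
def bEhat (l : ℕ) (i j : ℤ) : BFock l → BFock l :=
  fun x => -(∑ p : Fin l, nGam l true p (1 - i) false p j x)

/-- `ê*^{pq} = Σ_{r∈½+ℤ} :γ^{+,p}_{-r} γ^{-,q}_{r}:` (a locally finite sum; `r = k - ½`). -/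
def bestar (l : ℕ) (p q : Fin l) : BFock l → BFock l :=
  fun x => ∑ᶠ k : ℤ, nGam l true p (1 - k) false q k x

/-- `ê^{pq} = Σ_{r∈½+ℤ} :γ^{-,p}_{-r} γ^{-,q}_{r}:`. -/
def bee (l : ℕ) (p q : Fin l) : BFock l → BFock l :=
  fun x => ∑ᶠ k : ℤ, nGam l false p (1 - k) false q k x

/-- `ê**^{pq} = Σ_{r∈½+ℤ} :γ^{+,p}_{-r} γ^{+,q}_{r}:`. -/
def bestarstar (l : ℕ) (p q : Fin l) : BFock l → BFock l :=
  fun x => ∑ᶠ k : ℤ, nGam l true p (1 - k) true q k x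

/-!
The Lie algebra `gl` of `ℤ×ℤ` complex matrices with finitely many nonzero diagonals.
-/

/-- A `ℤ×ℤ` matrix (given as `a : ℤ → ℤ → ℂ`, `a i j` the `(i,j)` entry) belongs to `gl`
iff it has only finitely many nonzero diagonals. -/
def IsGL (a : ℤ → ℤ → ℂ) : Prop := ∃ N : ℕ, ∀ i j : ℤ, (N : ℤ) < |i - j| → a i j = 0

/-- The matrix product on `gl`: each entry is a (finitely supported) sum. -/
def glMul (a b : ℤ → ℤ → ℂ) : ℤ → ℤ → ℂ := fun i j => ∑ᶠ k : ℤ, a i k * b k j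

/-- The bracket `[a,b] = ab - ba` on `gl`. -/
def glBracket (a b : ℤ → ℤ → ℂ) : ℤ → ℤ → ℂ := fun i j => glMul a b i j - glMul b a i j

/-- The elementary matrix `E_{ij}`. -/
def Emat (i j : ℤ) : ℤ → ℤ → ℂ := fun m n => if m = i ∧ n = j then 1 else 0

/-- The 2-cocycle `C(a,b) = Σ_{i≤0<j} a_{ij} b_{ji} - Σ_{j≤0<i} a_{ij} b_{ji}` on `gl`
(both sums are finitely supported for `a, b ∈ gl`). -/
def glCocycle (a b : ℤ → ℤ → ℂ) : ℂ :=
  (∑ᶠ p : ℤ × ℤ, if p.1 ≤ 0 ∧ 0 < p.2 then a p.1 p.2 * b p.2 p.1 else 0) -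
  (∑ᶠ p : ℤ × ℤ, if p.2 ≤ 0 ∧ 0 < p.1 then a p.1 p.2 * b p.2 p.1 else 0)

/-- The action `Ê(a) x := Σ_{i,j ∈ ℤ} a_{ij} Ê_{ij} x` of `gl` on the bosonic Fock space
(the sum is finitely supported for each `x`, by part (1) of the theorem below). -/
def bEhatGL (l : ℕ) (a : ℤ → ℤ → ℂ) : BFock l → BFock l :=
  fun x => ∑ᶠ p : ℤ × ℤ, a p.1 p.2 • bEhat l p.1 p.2 x

/-! ### Modes as linear operators and their commutation relations -/

/-- The mode `boson l ε p k` as a linear operator. -/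
def bosonLin (l : ℕ) (ε : Bool) (p : Fin l) (k : ℤ) : Module.End ℂ (BFock l) :=
  if k ≤ 0 then LinearMap.mulLeft ℂ (MvPolynomial.X ((ε, p, (-k).toNat) : BBas l))
  else if ε then
    (MvPolynomial.pderiv ((false, p, (k - 1).toNat) : BBas l)).toLinearMap
  else -(MvPolynomial.pderiv ((true, p, (k - 1).toNat) : BBas l)).toLinearMap

theorem boson_eq_bosonLin (l : ℕ) (ε : Bool) (p : Fin l) (k : ℤ) (x : BFock l) :
    boson l ε p k x = bosonLin l ε p k x := by
  unfold boson bosonLin gamCr gamAn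
  split_ifs <;> simp

theorem MvPolynomial.pderiv_comm {σ R : Type*} [CommRing R] (i j : σ) (f : MvPolynomial σ R) :
    pderiv i (pderiv j f) = pderiv j (pderiv i f) := by
  classical
  have h : ⁅pderiv (R := R) i, pderiv (R := R) j⁆ = 0 := by
    ext k : 1
    simp only [Derivation.commutator_apply, pderiv_X, Pi.single_apply, Derivation.coe_zero,
      Pi.zero_apply]
    split_ifs <;> simp
  exact sub_eq_zero.1 (by simpa [Derivation.commutator_apply] using congrArg (fun D => D f) h)

theorem bosonLin_mul_same (l : ℕ) (ε : Bool) (p q : Fin l) (k k' : ℤ) :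
    bosonLin l ε p k * bosonLin l ε q k' = bosonLin l ε q k' * bosonLin l ε p k := by
  refine LinearMap.ext fun x => ?_
  cases ε <;> by_cases hk : k ≤ 0 <;> by_cases hk' : k' ≤ 0 <;>
    simp [bosonLin, hk, hk', mul_left_comm, MvPolynomial.pderiv_comm]

theorem bosonLin_mul_opposite (l : ℕ) (p q : Fin l) (i j : ℤ) :
    bosonLin l true p (1 - i) * bosonLin l false q j
      = bosonLin l false q j * bosonLin l true p (1 - i) + if p = q ∧ i = j then 1 else 0 := by
  refine LinearMap.ext fun x => ?_
  by_cases hi : 1 - i ≤ 0 <;> by_cases hj : j ≤ 0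
  · rw [if_neg (by omega)]
    simp [bosonLin, hi, hj, mul_left_comm]
  · by_cases h : p = q ∧ i = j
    · obtain ⟨rfl, rfl⟩ := h
      simp [bosonLin, hi, hj]
    · simp only [bosonLin, hi, hj, h, if_true, if_false, add_zero, Module.End.mul_apply]
      simp [Pi.single_apply]
      intro h1 h2
      exact absurd ⟨h1, by omega⟩ h
  · by_cases h : p = q ∧ i = j
    · obtain ⟨rfl, rfl⟩ := h
      simp [bosonLin, hi, hj, add_comm]
    · have h' : ¬ (q = p ∧ (-j).toNat = (-i).toNat) := by
        rintro ⟨h1, h2⟩; exact h ⟨h1.symm, by omega⟩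
      simp [bosonLin, hi, hj, h, h']
  · rw [if_neg (by omega)]
    simp [bosonLin, hi, hj, MvPolynomial.pderiv_comm]

/-- Quadratic elements in Heisenberg generators span a copy of `gl` (with a sign). -/
theorem commutator_sum_mul {R ι κ : Type*} [Ring R] [Fintype ι] [DecidableEq ι] [DecidableEq κ]
    (A B : ι → κ → R)
    (hA : ∀ p q i j, A p i * A q j = A q j * A p i)
    (hB : ∀ p q i j, B p i * B q j = B q j * B p i)
    (hAB : ∀ p q i j, A p i * B q j = B q j * A p i + if p = q ∧ i = j then 1 else 0)
    (i j m n : κ) :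
    (∑ p, A p i * B p j) * (∑ p, A p m * B p n) - (∑ p, A p m * B p n) * (∑ p, A p i * B p j)
      = (if i = n then ∑ p, A p m * B p j else 0) - (if j = m then ∑ p, A p i * B p n else 0) := by
  have hterm (p q : ι) : A p i * B p j * (A q m * B q n) - A q m * B q n * (A p i * B p j)
      = if p = q then (if i = n then A p m * B p j else 0) - (if j = m then A p i * B p n else 0)
        else 0 := by
    have h1 : A p i * B p j * (A q m * B q n)
        = A p i * A q m * (B p j * B q n) - A p i * (if q = p ∧ m = j then 1 else 0) * B q n := by
      have := hAB q p m j
      rw [← sub_eq_iff_eq_add] at this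
      calc _ = A p i * (B p j * A q m) * B q n := by noncomm_ring
        _ = _ := by rw [← this]; noncomm_ring
    have h2 : A q m * B q n * (A p i * B p j)
        = A p i * A q m * (B p j * B q n) - A q m * (if p = q ∧ i = n then 1 else 0) * B p j := by
      have := hAB p q i n
      rw [← sub_eq_iff_eq_add] at this
      calc _ = A q m * (B q n * A p i) * B p j := by noncomm_ring
        _ = A q m * A p i * (B q n * B p j) - A q m * (if p = q ∧ i = n then 1 else 0) * B p j := by
          rw [← this]; noncomm_ring
        _ = _ := by rw [hA q p, hB q p]
    rw [h1, h2]
    by_cases hpq : p = q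
    · subst hpq
      by_cases hin : i = n <;> by_cases hjm : j = m <;> simp [hin, hjm, eq_comm]
    · simp [hpq, Ne.symm hpq]
  rw [Finset.sum_mul_sum, Finset.sum_mul_sum, Finset.sum_comm (s := Finset.univ),
    ← Finset.sum_sub_distrib]
  simp_rw [← Finset.sum_sub_distrib]
  rw [Finset.sum_comm]
  simp_rw [hterm]
  by_cases hin : i = n <;> by_cases hjm : j = m <;> simp [hin, hjm]

theorem commutator_neg_add_algebraMap {R A : Type*} [CommRing R] [Ring A] [Algebra R A] (S T : A)
    (c d : R) :
    (-S + algebraMap R A c) * (-T + algebraMap R A d)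
      - (-T + algebraMap R A d) * (-S + algebraMap R A c) = S * T - T * S := by
  have h1 := Algebra.commutes c T
  have h2 := Algebra.commutes d S
  have h3 := Algebra.commutes c (algebraMap R A d)
  simp only [add_mul, mul_add, neg_mul, mul_neg, h1, h2, h3]
  abel

/-! ### The operators `Ê_{ij}` -/

/-- `Ê_{ij}` as a linear operator. -/
def bEhatLin (l : ℕ) (i j : ℤ) : Module.End ℂ (BFock l) :=
  -(∑ p : Fin l, bosonLin l true p (1 - i) * bosonLin l false p j)
    + algebraMap ℂ _ (if i = j ∧ i ≤ 0 then (l : ℂ) else 0)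

theorem bEhat_eq_bEhatLin (l : ℕ) (i j : ℤ) (x : BFock l) :
    bEhat l i j x = bEhatLin l i j x := by
  have hn (p : Fin l) : nGam l true p (1 - i) false p j x
      = (bosonLin l true p (1 - i) * bosonLin l false p j) x
        - (if i = j ∧ i ≤ 0 then (1 : ℂ) else 0) • x := by
    unfold nGam
    simp only [boson_eq_bosonLin]
    rw [bosonLin_mul_opposite]
    by_cases h : i = j ∧ i ≤ 0
    · rw [if_pos (by omega)]
      simp [h.1, h.1 ▸ h.2]
    · by_cases h' : 1 ≤ 1 - i ∧ j ≤ 0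
      · rw [if_pos h', if_neg (by omega), if_neg h]
        simp
      · rw [if_neg h', if_neg h, ← bosonLin_mul_opposite]
        simp
  unfold bEhat bEhatLin
  simp only [hn, Finset.sum_sub_distrib]
  split_ifs <;> simp [sub_eq_add_neg, add_comm, Algebra.algebraMap_eq_smul_one]

theorem bEhatLin_commutator (l : ℕ) (i j m n : ℤ) :
    bEhatLin l i j * bEhatLin l m n - bEhatLin l m n * bEhatLin l i j
      = (if j = m then bEhatLin l i n else 0) - (if i = n then bEhatLin l m j else 0)
        - algebraMap ℂ _ ((l : ℂ) * (if j = m then 1 else 0) * (if i = n then 1 else 0)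
            * ((if i ≤ 0 then (1 : ℂ) else 0) - (if j ≤ 0 then (1 : ℂ) else 0))) := by
  have hT := commutator_sum_mul (fun (p : Fin l) i => bosonLin l true p (1 - i))
    (fun p j => bosonLin l false p j) (fun p q i j => bosonLin_mul_same ..)
    (fun p q i j => bosonLin_mul_same ..) (fun p q i j => bosonLin_mul_opposite ..) i j m n
  unfold bEhatLin
  rw [commutator_neg_add_algebraMap, hT]
  by_cases hin : i = n <;> by_cases hjm : j = m
  · subst hin hjm
    by_cases hi : i ≤ 0 <;> by_cases hj : j ≤ 0 <;> simp [hi, hj] <;> abel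
  · simp [hin, hjm, Ne.symm hjm]
  · simp [hin, hjm]
  · simp [hin, hjm]

theorem MvPolynomial.exists_bound_pderiv_eq_zero {α β R : Type*} [CommSemiring R]
    (f : MvPolynomial (α × β × ℕ) R) :
    ∃ K : ℕ, ∀ a b n, K ≤ n → pderiv (a, b, n) f = 0 := by
  classical
  refine ⟨f.vars.sup (fun v => v.2.2) + 1, fun a b n hn => ?_⟩
  refine pderiv_eq_zero_of_notMem_vars fun h => ?_
  have := Finset.le_sup (f := fun v : α × β × ℕ => v.2.2) h
  simp only at this
  omega

theorem bEhatLin_locally_finite (l : ℕ) (x : BFock l) :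
    ∃ K : ℕ, ∀ i j : ℤ, (i < -K ∨ (K : ℤ) < j) → bEhatLin l i j x = 0 := by
  obtain ⟨K, hK⟩ := MvPolynomial.exists_bound_pderiv_eq_zero x
  refine ⟨K, fun i j hij => ?_⟩
  rw [← bEhat_eq_bEhatLin]
  unfold bEhat
  rw [neg_eq_zero]
  refine Finset.sum_eq_zero fun p _ => ?_
  have hA (h : i < -K) : bosonLin l true p (1 - i) x = 0 := by
    rw [bosonLin, if_neg (by omega), if_pos rfl]
    exact hK _ _ _ (by omega)
  have hB (h : (K : ℤ) < j) : bosonLin l false p j x = 0 := by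
    rw [bosonLin, if_neg (by omega)]
    simpa using hK _ _ _ (by omega)
  unfold nGam
  simp only [boson_eq_bosonLin]
  split_ifs with h <;> beta_reduce
  · rw [hA (by omega), map_zero]
  · rcases hij with hi | hj
    · have := congrArg (fun T => T x) (bosonLin_mul_opposite l p p i j)
      simp only [Module.End.mul_apply, LinearMap.add_apply] at this
      rw [this, hA hi, map_zero, if_neg (by omega), zero_add, LinearMap.zero_apply]
    · rw [hB hj, map_zero]

/-! ### Infinite sums over banded matrices -/

theorem mem_box_of_ne_zero {V : Type*} [AddCommGroup V] [Module ℂ V] {a : ℤ → ℤ → ℂ} {N K : ℕ}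
    (ha : ∀ i j : ℤ, (N : ℤ) < |i - j| → a i j = 0) {E : ℤ → ℤ → V}
    (hE : ∀ i j : ℤ, (i < -K ∨ (K : ℤ) < j) → E i j = 0) {M : ℤ} (hM : (K : ℤ) + N ≤ M)
    {p : ℤ × ℤ} (hp : a p.1 p.2 • E p.1 p.2 ≠ 0) :
    p ∈ Finset.Icc (-M) M ×ˢ Finset.Icc (-M) M := by
  have h1 : ¬ ((N : ℤ) < |p.1 - p.2|) := fun h => hp (by rw [ha _ _ h, zero_smul])
  have h2 : ¬ (p.1 < -K ∨ (K : ℤ) < p.2) := fun h => hp (by rw [hE _ _ h, smul_zero])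
  rw [not_lt, abs_le] at h1
  simp only [Finset.mem_product, Finset.mem_Icc]
  omega

theorem finsum_smul_eq_sum_box {V : Type*} [AddCommGroup V] [Module ℂ V] {a : ℤ → ℤ → ℂ}
    {N K : ℕ} (ha : ∀ i j : ℤ, (N : ℤ) < |i - j| → a i j = 0) {E : ℤ → ℤ → V}
    (hE : ∀ i j : ℤ, (i < -K ∨ (K : ℤ) < j) → E i j = 0) {M : ℤ} (hM : (K : ℤ) + N ≤ M) :
    ∑ᶠ p : ℤ × ℤ, a p.1 p.2 • E p.1 p.2
      = ∑ i ∈ Finset.Icc (-M) M, ∑ j ∈ Finset.Icc (-M) M, a i j • E i j := by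
  rw [finsum_eq_sum_of_support_subset _ (s := Finset.Icc (-M) M ×ˢ Finset.Icc (-M) M)
    fun p hp => mem_box_of_ne_zero ha hE hM hp, Finset.sum_product]

theorem glMul_eq_zero {a b : ℤ → ℤ → ℂ} {N : ℕ}
    (ha : ∀ i j : ℤ, (N : ℤ) < |i - j| → a i j = 0)
    (hb : ∀ i j : ℤ, (N : ℤ) < |i - j| → b i j = 0) (i j : ℤ)
    (hij : ((2 * N : ℕ) : ℤ) < |i - j|) : glMul a b i j = 0 := by
  refine finsum_eq_zero_of_forall_eq_zero fun k => ?_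
  by_cases h : (N : ℤ) < |i - k|
  · rw [ha _ _ h, zero_mul]
  · rw [hb k j (by grind), mul_zero]

theorem glMul_eq_sum {a b : ℤ → ℤ → ℂ} {N : ℕ}
    (ha : ∀ i j : ℤ, (N : ℤ) < |i - j| → a i j = 0)
    (hb : ∀ i j : ℤ, (N : ℤ) < |i - j| → b i j = 0) {i j M : ℤ}
    (hi : -M ≤ i - N) (hj : j + N ≤ M) :
    glMul a b i j = ∑ k ∈ Finset.Icc (-M) M, a i k * b k j := by
  refine finsum_eq_sum_of_support_subset _ fun k hk => ?_
  have h1 : ¬ ((N : ℤ) < |i - k|) := fun h => hk (by simp [ha _ _ h])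
  have h2 : ¬ ((N : ℤ) < |k - j|) := fun h => hk (by simp [hb _ _ h])
  rw [not_lt, abs_le] at h1 h2
  simp only [Finset.coe_Icc, Set.mem_Icc]
  omega

theorem glCocycle_eq_sum {a b : ℤ → ℤ → ℂ} {N : ℕ}
    (ha : ∀ i j : ℤ, (N : ℤ) < |i - j| → a i j = 0) {M : ℤ} (hM : (N : ℤ) ≤ M) :
    glCocycle a b = ∑ i ∈ Finset.Icc (-M) M, ∑ j ∈ Finset.Icc (-M) M,
      a i j * b j i * ((if i ≤ 0 then (1 : ℂ) else 0) - (if j ≤ 0 then (1 : ℂ) else 0)) := by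
  unfold glCocycle
  rw [finsum_eq_sum_of_support_subset (s := Finset.Icc (-M) M ×ˢ Finset.Icc (-M) M),
    finsum_eq_sum_of_support_subset (s := Finset.Icc (-M) M ×ˢ Finset.Icc (-M) M),
    ← Finset.sum_sub_distrib, Finset.sum_product]
  · refine Finset.sum_congr rfl fun i _ => Finset.sum_congr rfl fun j _ => ?_
    by_cases hi : i ≤ 0 <;> by_cases hj : j ≤ 0 <;>
      simp [hi, hj, not_lt.2, not_le.1]
  all_goals
    intro p hp
    have h1 : ¬ ((N : ℤ) < |p.1 - p.2|) := fun h => hp (by simp [ha _ _ h])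
    rw [Function.mem_support, ne_eq, ite_eq_right_iff, Classical.not_imp] at hp
    rw [not_lt, abs_le] at h1
    simp only [Finset.coe_product, Finset.coe_Icc, Set.mem_prod, Set.mem_Icc]
    omega

theorem sum_sum_comm_sum_sum {ι M : Type*} [AddCommMonoid M] (S : Finset ι)
    (f : ι → ι → ι → ι → M) :
    ∑ i ∈ S, ∑ j ∈ S, ∑ m ∈ S, ∑ n ∈ S, f i j m n
      = ∑ m ∈ S, ∑ n ∈ S, ∑ i ∈ S, ∑ j ∈ S, f i j m n := by
  simpa only [Finset.sum_product] using
    Finset.sum_comm (s := S ×ˢ S) (t := S ×ˢ S) (f := fun p q => f p.1 p.2 q.1 q.2)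

/-- The commutator of two locally finite sums, computed from the commutators of the summands. -/
theorem commutator_finsum {V : Type*} [AddCommGroup V] [Module ℂ V] (E : ℤ → ℤ → Module.End ℂ V)
    (c : ℂ)
    (hfin : ∀ x, ∃ K : ℕ, ∀ i j : ℤ, (i < -K ∨ (K : ℤ) < j) → E i j x = 0)
    (hE : ∀ i j m n, E i j * E m n - E m n * E i j
      = (if j = m then E i n else 0) - (if i = n then E m j else 0)
        - algebraMap ℂ _ (c * (if j = m then 1 else 0) * (if i = n then 1 else 0)
            * ((if i ≤ 0 then (1 : ℂ) else 0) - (if j ≤ 0 then (1 : ℂ) else 0))))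
    {a b : ℤ → ℤ → ℂ} (ha : IsGL a) (hb : IsGL b) (x : V) :
    (∑ᶠ p : ℤ × ℤ, a p.1 p.2 • E p.1 p.2 (∑ᶠ q : ℤ × ℤ, b q.1 q.2 • E q.1 q.2 x))
        - (∑ᶠ p : ℤ × ℤ, b p.1 p.2 • E p.1 p.2 (∑ᶠ q : ℤ × ℤ, a q.1 q.2 • E q.1 q.2 x))
      = (∑ᶠ p : ℤ × ℤ, glBracket a b p.1 p.2 • E p.1 p.2 x) - (c * glCocycle a b) • x := by
  obtain ⟨N₁, ha⟩ := ha
  obtain ⟨N₂, hb⟩ := hb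
  obtain ⟨N, hN₁, hN₂⟩ : ∃ N, N₁ ≤ N ∧ N₂ ≤ N := ⟨max N₁ N₂, le_max_left .., le_max_right ..⟩
  replace ha : ∀ i j : ℤ, (N : ℤ) < |i - j| → a i j = 0 := fun i j h => ha i j (by omega)
  replace hb : ∀ i j : ℤ, (N : ℤ) < |i - j| → b i j = 0 := fun i j h => hb i j (by omega)
  have hab : ∀ i j : ℤ, ((2 * N : ℕ) : ℤ) < |i - j| → glBracket a b i j = 0 := fun i j h => by
    rw [glBracket, glMul_eq_zero ha hb i j h, glMul_eq_zero hb ha i j h, sub_zero]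
  set y := ∑ᶠ q : ℤ × ℤ, b q.1 q.2 • E q.1 q.2 x with hy
  set z := ∑ᶠ q : ℤ × ℤ, a q.1 q.2 • E q.1 q.2 x with hz
  obtain ⟨Kx, hx⟩ := hfin x
  obtain ⟨Ky, hKy⟩ := hfin y
  obtain ⟨Kz, hKz⟩ := hfin z
  obtain ⟨M, hM⟩ : ∃ M : ℤ, M = Kx + Ky + Kz + 2 * N := ⟨_, rfl⟩
  rw [finsum_smul_eq_sum_box (M := M) ha hKy (by omega),
    finsum_smul_eq_sum_box (M := M) hb hKz (by omega),
    finsum_smul_eq_sum_box (M := M) hab hx (by push_cast; omega),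
    glCocycle_eq_sum (M := M) ha (by omega)]
  rw [finsum_smul_eq_sum_box (M := M) hb hx (by omega)] at hy
  rw [finsum_smul_eq_sum_box (M := M) ha hx (by omega)] at hz
  set S := Finset.Icc (-M) M
  have hbr (i n : ℤ) : glBracket a b i n • E i n x
      = (∑ j ∈ S, (a i j * b j n) • E i n x) - ∑ j ∈ S, (b i j * a j n) • E i n x := by
    by_cases h : i < -Kx ∨ (Kx : ℤ) < n
    · simp [hx i n h]
    · rw [glBracket, glMul_eq_sum (M := M) ha hb (by omega) (by omega),
        glMul_eq_sum (M := M) hb ha (by omega) (by omega), sub_smul, Finset.sum_smul,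
        Finset.sum_smul]
  have hEx (i j m n : ℤ) : E i j (E m n x) = E m n (E i j x)
      + ((if j = m then E i n x else 0) - (if i = n then E m j x else 0)
        - (c * (if j = m then 1 else 0) * (if i = n then 1 else 0)
            * ((if i ≤ 0 then (1 : ℂ) else 0) - (if j ≤ 0 then (1 : ℂ) else 0))) • x) := by
    have h := congrArg (fun T => T x) (hE i j m n)
    simp only [LinearMap.sub_apply, Module.End.mul_apply, Module.algebraMap_end_apply] at h
    rw [← sub_eq_iff_eq_add', h]
    split_ifs <;> rfl
  have hyz : ∑ i ∈ S, ∑ j ∈ S, a i j • E i j y - ∑ i ∈ S, ∑ j ∈ S, b i j • E i j z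
      = ∑ i ∈ S, ∑ j ∈ S, ∑ m ∈ S, ∑ n ∈ S, (a i j * b m n) •
        ((if j = m then E i n x else 0) - (if i = n then E m j x else 0)
        - (c * (if j = m then 1 else 0) * (if i = n then 1 else 0)
            * ((if i ≤ 0 then (1 : ℂ) else 0) - (if j ≤ 0 then (1 : ℂ) else 0))) • x) := by
    have hz' : ∑ i ∈ S, ∑ j ∈ S, b i j • E i j z
        = ∑ i ∈ S, ∑ j ∈ S, ∑ m ∈ S, ∑ n ∈ S, (a i j * b m n) • E m n (E i j x) := by
      rw [sum_sum_comm_sum_sum]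
      simp only [hz, map_sum, map_smul, Finset.smul_sum, smul_smul, mul_comm]
    rw [hz', hy]
    simp only [map_sum, map_smul, Finset.smul_sum, smul_smul, ← Finset.sum_sub_distrib, ← smul_sub]
    refine Finset.sum_congr rfl fun i _ => Finset.sum_congr rfl fun j _ =>
      Finset.sum_congr rfl fun m _ => Finset.sum_congr rfl fun n _ => ?_
    rw [hEx i j m n, add_sub_cancel_left]
  rw [hyz]
  have h1 : ∑ i ∈ S, ∑ j ∈ S, ∑ m ∈ S, ∑ n ∈ S, (a i j * b m n) • (if j = m then E i n x else 0)
      = ∑ i ∈ S, ∑ n ∈ S, ∑ j ∈ S, (a i j * b j n) • E i n x := by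
    refine Finset.sum_congr rfl fun i _ => ?_
    rw [Finset.sum_comm (s := S) (t := S) (f := fun n j => (a i j * b j n) • E i n x)]
    refine Finset.sum_congr rfl fun j hj => ?_
    rw [Finset.sum_comm]
    refine Finset.sum_congr rfl fun n _ => ?_
    simp [hj]
  have h2 : ∑ i ∈ S, ∑ j ∈ S, ∑ m ∈ S, ∑ n ∈ S, (a i j * b m n) • (if i = n then E m j x else 0)
      = ∑ m ∈ S, ∑ j ∈ S, ∑ i ∈ S, (b m i * a i j) • E m j x := by
    have : ∀ i ∈ S, ∑ j ∈ S, ∑ m ∈ S, ∑ n ∈ S, (a i j * b m n) • (if i = n then E m j x else 0)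
        = ∑ m ∈ S, ∑ j ∈ S, (b m i * a i j) • E m j x := fun i hi => by
      rw [Finset.sum_comm]
      refine Finset.sum_congr rfl fun m _ => Finset.sum_congr rfl fun j _ => ?_
      simp [hi, mul_comm]
    rw [Finset.sum_congr rfl this, Finset.sum_comm]
    exact Finset.sum_congr rfl fun m _ => Finset.sum_comm
  have h3 : ∑ i ∈ S, ∑ j ∈ S, ∑ m ∈ S, ∑ n ∈ S, (a i j * b m n) •
        (c * (if j = m then 1 else 0) * (if i = n then 1 else 0)
            * ((if i ≤ 0 then (1 : ℂ) else 0) - (if j ≤ 0 then (1 : ℂ) else 0))) • x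
      = (c * ∑ i ∈ S, ∑ j ∈ S, a i j * b j i *
          ((if i ≤ 0 then (1 : ℂ) else 0) - (if j ≤ 0 then (1 : ℂ) else 0))) • x := by
    simp only [smul_smul, ← Finset.sum_smul, Finset.mul_sum]
    congr 1
    refine Finset.sum_congr rfl fun i hi => Finset.sum_congr rfl fun j hj => ?_
    rw [Finset.sum_eq_single_of_mem j hj, Finset.sum_eq_single_of_mem i hi]
    · simp only [if_true]; ring
    · intro n _ hn
      simp [hn.symm]
    · intro m _ hm
      simp [hm.symm]
  simp only [smul_sub, Finset.sum_sub_distrib, hbr] at h1 h2 h3 ⊢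
  rw [h1, h2, h3]

/-- (1) for `a ∈ gl` and `x ∈ F`, only finitely many terms of
`Σ_{i,j} a_{ij} Ê_{ij} x` are nonzero, so `Ê : gl → End(F)` is well defined;
(2) `[Ê(a), Ê(b)] = Ê(ab - ba) - l·C(a,b)·id`, i.e. `a + λC ↦ Ê(a) - λ·l·id` is a
representation of the central extension `ĝl = gl ⊕ ℂC` on `F`; in particular
`[Ê_{ij}, Ê_{mn}] = δ_{jm} Ê_{in} - δ_{in} Ê_{mj} - l·δ_{jm}δ_{in}(χ(i≤0) - χ(j≤0))·id`. -/
theorem bEhatGL_wellDefined_and_representation (l : ℕ) (hl : 1 ≤ l) :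
    (∀ (a : ℤ → ℤ → ℂ), IsGL a → ∀ x : BFock l,
      {p : ℤ × ℤ | a p.1 p.2 • bEhat l p.1 p.2 x ≠ 0}.Finite) ∧
    (∀ (a b : ℤ → ℤ → ℂ), IsGL a → IsGL b → ∀ x : BFock l,
      bEhatGL l a (bEhatGL l b x) - bEhatGL l b (bEhatGL l a x)
        = bEhatGL l (glBracket a b) x - ((l : ℂ) * glCocycle a b) • x) ∧
    (∀ (i j m n : ℤ) (x : BFock l),
      bEhat l i j (bEhat l m n x) - bEhat l m n (bEhat l i j x)
        = (if j = m then bEhat l i n x else 0) - (if i = n then bEhat l m j x else 0)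
          - (((l : ℂ) * (if j = m then 1 else 0) * (if i = n then 1 else 0)
              * ((if i ≤ 0 then (1 : ℂ) else 0) - (if j ≤ 0 then (1 : ℂ) else 0))) • x)) := by
  refine ⟨fun a ⟨N, ha⟩ x => ?_, fun a b ha hb x => ?_, fun i j m n x => ?_⟩
  · obtain ⟨K, hK⟩ := bEhatLin_locally_finite l x
    simp only [bEhat_eq_bEhatLin]
    exact (Finset.finite_toSet _).subset fun p hp => mem_box_of_ne_zero ha hK le_rfl hp
  · simp only [bEhatGL, bEhat_eq_bEhatLin]
    exact commutator_finsum (bEhatLin l) l (bEhatLin_locally_finite l) (bEhatLin_commutator l)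
      ha hb x
  · simp only [bEhat_eq_bEhatLin]
    have h := congrArg (fun T => T x) (bEhatLin_commutator l i j m n)
    simp only [LinearMap.sub_apply, Module.End.mul_apply, Module.algebraMap_end_apply] at h
    rw [h]
    split_ifs <;> rfl

end
end

section
/- (1) For all 1 ≤ p, q ≤ l and all i, j ∈ ℤ, [ê*^{pq}, Ê_{ij}] = 0. (2) For all 1 ≤ p, q ≤ l and all i, j ∈ ℤ, the operator D̂_{ij} := Ê_{ij} − Ê_{1−j,1−i} satisfies [D̂_{ij}, ê^{pq}] = 0 and [D̂_{ij}, ê**^{pq}] = 0. -/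
/-!
Bosonic Fock space of `l` pairs of bosonic ghost fields indexed by `½ + ℤ`.

The Fock space `BFock l` is the polynomial algebra `ℂ[x^{ε,p}_r]` with
`ε ∈ {+,-}` (encoded as `Bool`, `true = +`), `1 ≤ p ≤ l` (encoded as `Fin l`) and
`r ∈ ½+ℤ`, `r > 0` (encoded as `n : ℕ` with `r = n + ½`), with vacuum `|0⟩ = 1`.

For `r > 0`, `γ^{ε,p}_{-r}` is multiplication by `x^{ε,p}_r`, while
`γ^{+,p}_{r} = ∂/∂x^{-,p}_r` and `γ^{-,p}_{r} = -∂/∂x^{+,p}_r`.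
A general mode `γ^{ε,p}_{k-½}` is encoded by `boson ε p k` for `k : ℤ`.
-/

noncomputable section

/-- `D̂_{ij} := Ê_{ij} - Ê_{1-j,1-i}`. -/
def bDhat (l : ℕ) (i j : ℤ) : BFock l → BFock l :=
  fun x => bEhat l i j x - bEhat l (1 - j) (1 - i) x

namespace BosonicFock

open MvPolynomial

/-- The mode `γ^{ε,p}_{k-½}` as a linear endomorphism of the Fock space. -/
def bosonEnd (l : ℕ) (ε : Bool) (p : Fin l) (k : ℤ) : Module.End ℂ (BFock l) :=
  if k ≤ 0 then LinearMap.mulLeft ℂ (X (ε, p, (-k).toNat))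
  else (if ε then (1 : ℂ) else -1) • (pderiv (!ε, p, (k - 1).toNat)).toLinearMap

/-- The scalar `[γ^{ε₁,p}_{k-½}, γ^{ε₂,q}_{m-½}]`. -/
def bosonPairing (l : ℕ) (ε₁ : Bool) (p : Fin l) (k : ℤ) (ε₂ : Bool) (q : Fin l) (m : ℤ) : ℂ :=
  if ε₁ ≠ ε₂ ∧ p = q ∧ k + m = 1 then (if ε₁ then 1 else -1) else 0

variable {l : ℕ}

lemma boson_eq_bosonEnd (ε : Bool) (p : Fin l) (k : ℤ) (x : BFock l) :
    boson l ε p k x = bosonEnd l ε p k x := by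
  unfold boson bosonEnd gamCr gamAn
  cases ε <;> split_ifs <;> simp_all

lemma pderiv_comm {σ R : Type*} [CommRing R] (i j : σ) (f : MvPolynomial σ R) :
    pderiv i (pderiv j f) = pderiv j (pderiv i f) := by
  classical
  induction f using MvPolynomial.induction_on with
  | C a => simp
  | add f g hf hg => simp [hf, hg]
  | mul_X f k hf =>
    simp only [pderiv_mul, map_add, pderiv_X, Pi.single_apply, hf]
    split_ifs <;> simp
    ring

lemma lie_bosonEnd (ε₁ : Bool) (p : Fin l) (k : ℤ) (ε₂ : Bool) (q : Fin l) (m : ℤ) :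
    ⁅bosonEnd l ε₁ p k, bosonEnd l ε₂ q m⁆ = bosonPairing l ε₁ p k ε₂ q m • 1 := by
  refine LinearMap.ext fun x => ?_
  rw [Ring.lie_def]
  unfold bosonEnd
  by_cases hk : k ≤ 0 <;> by_cases hm : m ≤ 0
  · have h : k + m ≠ 1 := by omega
    simp [hk, hm, bosonPairing, h]
    ring
  · have h : (-k).toNat = m.toNat - 1 ↔ k + m = 1 := by omega
    simp [hk, hm, bosonPairing]
    cases ε₁ <;> cases ε₂ <;> by_cases hp : p = q <;> by_cases h1 : k + m = 1 <;> simp_all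
  · have h : (-m).toNat = k.toNat - 1 ↔ k + m = 1 := by omega
    simp [hk, hm, bosonPairing]
    cases ε₁ <;> cases ε₂ <;> by_cases hp : p = q <;> by_cases h1 : k + m = 1 <;>
      simp_all [eq_comm]
  · have h : k + m ≠ 1 := by omega
    simp [hk, hm, bosonPairing, h]
    cases ε₁ <;> cases ε₂ <;> simp [pderiv_comm (_, p, _)]

/-- A normally ordered product differs from the plain product by a scalar. -/
lemma exists_nGam_eq (ε₁ : Bool) (p : Fin l) (k : ℤ) (ε₂ : Bool) (q : Fin l) (m : ℤ) :
    ∃ c : ℂ, ∀ x, nGam l ε₁ p k ε₂ q m x =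
      (bosonEnd l ε₁ p k * bosonEnd l ε₂ q m + c • 1) x := by
  by_cases h : 1 ≤ k ∧ m ≤ 0
  · refine ⟨-bosonPairing l ε₁ p k ε₂ q m, fun x => ?_⟩
    have hL := LinearMap.congr_fun (lie_bosonEnd ε₁ p k ε₂ q m) x
    simp only [Ring.lie_def, LinearMap.sub_apply, Module.End.mul_apply, LinearMap.smul_apply,
      Module.End.one_apply] at hL
    simp [nGam, h, boson_eq_bosonEnd, ← hL]
  · exact ⟨0, fun x => by simp [nGam, h, boson_eq_bosonEnd]⟩

/-- Annihilation operators of large index kill a given polynomial. -/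
lemma exists_bosonEnd_eq_zero (ε : Bool) (p : Fin l) (x : BFock l) :
    ∃ K : ℤ, 0 ≤ K ∧ ∀ k, K < k → bosonEnd l ε p k x = 0 := by
  refine ⟨x.vars.sup (fun v => v.2.2) + 1, by positivity, fun k hk => ?_⟩
  have h0 : ¬ k ≤ 0 := by omega
  have hv : ((!ε, p, (k - 1).toNat) : BBas l) ∉ x.vars := fun hmem => by
    have := Finset.le_sup (f := fun v : BBas l => v.2.2) hmem
    dsimp only at this
    omega
  rw [bosonEnd, if_neg h0]
  cases ε <;> simp_all [pderiv_eq_zero_of_notMem_vars]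

lemma finite_support_nGam (ε₁ ε₂ : Bool) (p q : Fin l) (x : BFock l) :
    (Function.support fun k : ℤ => nGam l ε₁ p (1 - k) ε₂ q k x).Finite := by
  obtain ⟨K, hK, hp⟩ := exists_bosonEnd_eq_zero ε₁ p x
  obtain ⟨M, hM, hq⟩ := exists_bosonEnd_eq_zero ε₂ q x
  refine (Set.finite_Icc (-K) M).subset fun k hk => ?_
  by_contra hmem
  rw [Set.mem_Icc, not_and_or] at hmem
  refine hk ?_
  rcases hmem with h | h
  · have h1 : 1 ≤ 1 - k ∧ k ≤ 0 := by omega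
    simp only [nGam, if_pos h1, boson_eq_bosonEnd]
    rw [hp _ (by omega), map_zero]
  · have h1 : ¬ (1 ≤ 1 - k ∧ k ≤ 0) := by omega
    simp only [nGam, if_neg h1, boson_eq_bosonEnd]
    rw [hq _ (by omega), map_zero]

lemma finsum_nGam_sub (ε₁ ε₂ : Bool) (p q : Fin l) (x y : BFock l) :
    ∑ᶠ k : ℤ, nGam l ε₁ p (1 - k) ε₂ q k (x - y) =
      ∑ᶠ k : ℤ, nGam l ε₁ p (1 - k) ε₂ q k x - ∑ᶠ k : ℤ, nGam l ε₁ p (1 - k) ε₂ q k y := by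
  rw [← finsum_sub_distrib (finite_support_nGam ..) (finite_support_nGam ..)]
  refine finsum_congr fun k => ?_
  obtain ⟨c, hc⟩ := exists_nGam_eq ε₁ p (1 - k) ε₂ q k
  simp only [hc, map_sub]

/-- The commutator of an endomorphism with a quadratic operator, by the Leibniz rule. -/
lemma commutator_finsum_nGam (A : Module.End ℂ (BFock l)) (ε₁ ε₂ : Bool) (p q : Fin l)
    (x : BFock l) :
    A (∑ᶠ k : ℤ, nGam l ε₁ p (1 - k) ε₂ q k x) - ∑ᶠ k : ℤ, nGam l ε₁ p (1 - k) ε₂ q k (A x) =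
      ∑ᶠ k : ℤ, (⁅A, bosonEnd l ε₁ p (1 - k)⁆ (bosonEnd l ε₂ q k x) +
        bosonEnd l ε₁ p (1 - k) (⁅A, bosonEnd l ε₂ q k⁆ x)) := by
  have hfin := finite_support_nGam ε₁ ε₂ p q x
  have hfinA : (Function.support fun k : ℤ => A (nGam l ε₁ p (1 - k) ε₂ q k x)).Finite :=
    hfin.subset (Function.support_comp_subset (map_zero A) _)
  rw [map_finsum A hfin, ← finsum_sub_distrib hfinA (finite_support_nGam ..)]
  refine finsum_congr fun k => ?_
  obtain ⟨c, hc⟩ := exists_nGam_eq ε₁ p (1 - k) ε₂ q k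
  simp [hc, Ring.lie_def]

lemma finsum_ite_eq_add_ite_eq {M : Type*} [AddCommMonoid M] (a b : ℤ) (f g : ℤ → M) :
    ∑ᶠ k : ℤ, ((if k = a then f k else 0) + (if k = b then g k else 0)) = f a + g b := by
  have hs (a : ℤ) (f : ℤ → M) : (Function.support fun k => if k = a then f k else 0).Finite :=
    (Set.finite_singleton a).subset fun k hk => by
      by_contra h
      exact hk (if_neg h)
  have hf (a : ℤ) (f : ℤ → M) : ∑ᶠ k, (if k = a then f k else 0) = f a := by
    rw [finsum_eq_single _ a fun k hk => if_neg hk, if_pos rfl]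
  rw [finsum_add_distrib (hs a f) (hs b g), hf, hf]

lemma map_ite_zero {M N : Type*} [AddCommMonoid M] [Module ℂ M] [AddCommMonoid N] [Module ℂ N]
    (A : M →ₗ[ℂ] N) (P : Prop) [Decidable P] (x : M) :
    A (if P then x else 0) = if P then A x else 0 := by
  split_ifs <;> simp

/-- `Ê_{ij}` is linear, and its adjoint action on the modes. -/
lemma exists_bEhat_eq (l : ℕ) (i j : ℤ) : ∃ A : Module.End ℂ (BFock l),
    (∀ x, bEhat l i j x = A x) ∧
    (∀ q m, ⁅A, bosonEnd l true q m⁆ = if m = 1 - j then bosonEnd l true q (1 - i) else 0) ∧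
    (∀ q m, ⁅A, bosonEnd l false q m⁆ = if m = i then -bosonEnd l false q j else 0) := by
  choose c hc using fun p : Fin l => exists_nGam_eq true p (1 - i) false p j
  have leibniz (a b y : Module.End ℂ (BFock l)) (s : ℂ) :
      ⁅a * b + s • 1, y⁆ = a * ⁅b, y⁆ + ⁅a, y⁆ * b := by
    refine LinearMap.ext fun x => ?_
    simp [Ring.lie_def]
  have neg_sum_lie (f : Fin l → Module.End ℂ (BFock l)) (y : Module.End ℂ (BFock l)) :
      ⁅-∑ p, f p, y⁆ = -∑ p, ⁅f p, y⁆ := by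
    refine LinearMap.ext fun x => ?_
    simp [Ring.lie_def, LinearMap.sum_apply, map_sum]
    abel
  refine ⟨-∑ p, (bosonEnd l true p (1 - i) * bosonEnd l false p j + c p • 1),
    fun x => ?_, fun q m => ?_, fun q m => ?_⟩
  · simp only [bEhat, hc, LinearMap.neg_apply, LinearMap.sum_apply]
  · have h : j + m = 1 ↔ m = 1 - j := by omega
    simp only [neg_sum_lie, leibniz, lie_bosonEnd, bosonPairing, h]
    by_cases hm : m = 1 - j <;> simp [hm]
  · have h : 1 - i + m = 1 ↔ m = i := by omega
    simp only [neg_sum_lie, leibniz, lie_bosonEnd, bosonPairing, h]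
    by_cases hm : m = i <;> simp [hm]

lemma bEhat_bestar_commute (p q : Fin l) (i j : ℤ) (x : BFock l) :
    bEhat l i j (bestar l p q x) - bestar l p q (bEhat l i j x) = 0 := by
  obtain ⟨A, hA, hp, hm⟩ := exists_bEhat_eq l i j
  have h (k : ℤ) : 1 - k = 1 - j ↔ k = j := by omega
  simp only [hA, bestar, commutator_finsum_nGam, hp, hm, h, DFunLike.ite_apply,
    LinearMap.zero_apply, map_ite_zero, finsum_ite_eq_add_ite_eq]
  simp

lemma bEhat_bee_commutator (p q : Fin l) (i j : ℤ) (x : BFock l) :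
    bEhat l i j (bee l p q x) - bee l p q (bEhat l i j x) =
      -bosonEnd l false p j (bosonEnd l false q (1 - i) x) -
        bosonEnd l false p (1 - i) (bosonEnd l false q j x) := by
  obtain ⟨A, hA, hp, hm⟩ := exists_bEhat_eq l i j
  have h (k : ℤ) : 1 - k = i ↔ k = 1 - i := by omega
  simp only [hA, bee, commutator_finsum_nGam, hm, h, DFunLike.ite_apply,
    LinearMap.zero_apply, map_ite_zero, finsum_ite_eq_add_ite_eq]
  simp [sub_eq_add_neg]

lemma bEhat_bestarstar_commutator (p q : Fin l) (i j : ℤ) (x : BFock l) :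
    bEhat l i j (bestarstar l p q x) - bestarstar l p q (bEhat l i j x) =
      bosonEnd l true p (1 - i) (bosonEnd l true q j x) +
        bosonEnd l true p j (bosonEnd l true q (1 - i) x) := by
  obtain ⟨A, hA, hp, hm⟩ := exists_bEhat_eq l i j
  have h (k : ℤ) : 1 - k = 1 - j ↔ k = j := by omega
  simp only [hA, bestarstar, commutator_finsum_nGam, hp, h, DFunLike.ite_apply,
    LinearMap.zero_apply, map_ite_zero, finsum_ite_eq_add_ite_eq]
  simp

end BosonicFock

open BosonicFock in
/-- (1) `ê*^{pq}` commutes with all `Ê_{ij}`; (2) `D̂_{ij} = Ê_{ij} -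
Ê_{1-j,1-i}` commutes with all `ê^{pq}` and all `ê**^{pq}`. -/
theorem bestar_bDhat_commute (l : ℕ) (hl : 1 ≤ l) (p q : Fin l) (i j : ℤ) (x : BFock l) :
    bestar l p q (bEhat l i j x) = bEhat l i j (bestar l p q x) ∧
    bDhat l i j (bee l p q x) = bee l p q (bDhat l i j x) ∧
    bDhat l i j (bestarstar l p q x) = bestarstar l p q (bDhat l i j x) := by
  refine ⟨(sub_eq_zero.mp (bEhat_bestar_commute p q i j x)).symm, ?_, ?_⟩
  · have h₁ := bEhat_bee_commutator p q i j x
    have h₂ := bEhat_bee_commutator p q (1 - j) (1 - i) x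
    have hsub := finsum_nGam_sub false false p q (bEhat l i j x) (bEhat l (1 - j) (1 - i) x)
    rw [sub_sub_cancel] at h₂
    simp only [bDhat, bee] at *
    rw [hsub]
    linear_combination h₁ - h₂
  · have h₁ := bEhat_bestarstar_commutator p q i j x
    have h₂ := bEhat_bestarstar_commutator p q (1 - j) (1 - i) x
    have hsub := finsum_nGam_sub true true p q (bEhat l i j x) (bEhat l (1 - j) (1 - i) x)
    rw [sub_sub_cancel] at h₂
    simp only [bDhat, bestarstar] at *
    rw [hsub]
    linear_combination h₁ - h₂

end
end

section
/- For all i, j ∈ ℤ and all 1 ≤ p, q ≤ l, the operator Ĉ_{ij} := Ê_{ij} − (−1)^{i+j} Ê_{1−j,1−i} commutes with ê*^{pq}, with ẽ^{pq}, and with ẽ**^{pq}: [Ĉ_{ij}, ê*^{pq}] = [Ĉ_{ij}, ẽ^{pq}] = [Ĉ_{ij}, ẽ**^{pq}] = 0. -/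
/-!
Bosonic Fock space of `l` pairs of bosonic ghost fields indexed by `½ + ℤ`.

The Fock space `BFock l` is the polynomial algebra `ℂ[x^{ε,p}_r]` with
`ε ∈ {+,-}` (encoded as `Bool`, `true = +`), `1 ≤ p ≤ l` (encoded as `Fin l`) and
`r ∈ ½+ℤ`, `r > 0` (encoded as `n : ℕ` with `r = n + ½`), with vacuum `|0⟩ = 1`.

For `r > 0`, `γ^{ε,p}_{-r}` is multiplication by `x^{ε,p}_r`, while
`γ^{+,p}_{r} = ∂/∂x^{-,p}_r` and `γ^{-,p}_{r} = -∂/∂x^{+,p}_r`.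
A general mode `γ^{ε,p}_{k-½}` is encoded by `boson ε p k` for `k : ℤ`.
-/

noncomputable section

/-- `ẽ^{pq} = Σ_{r∈½+ℤ} (-1)^{r+½} :γ^{-,p}_{-r} γ^{-,q}_{r}:` (with `r = k - ½`, so that
`(-1)^{r+½} = (-1)^k`). -/
def beeTw (l : ℕ) (p q : Fin l) : BFock l → BFock l :=
  fun x => ∑ᶠ k : ℤ, ((-1 : ℂ) ^ k) • nGam l false p (1 - k) false q k x

/-- `ẽ**^{pq} = Σ_{r∈½+ℤ} (-1)^{r+½} :γ^{+,p}_{-r} γ^{+,q}_{r}:`. -/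
def bestarstarTw (l : ℕ) (p q : Fin l) : BFock l → BFock l :=
  fun x => ∑ᶠ k : ℤ, ((-1 : ℂ) ^ k) • nGam l true p (1 - k) true q k x

/-- `Ĉ_{ij} := Ê_{ij} - (-1)^{i+j} Ê_{1-j,1-i}`. -/
def bChat (l : ℕ) (i j : ℤ) : BFock l → BFock l :=
  fun x => bEhat l i j x - ((-1 : ℂ) ^ (i + j)) • bEhat l (1 - j) (1 - i) x

/-- The mode `γ^{ε,p}_{k-½}` as a linear endomorphism of the Fock space. -/
def bosonEnd (l : ℕ) (ε : Bool) (p : Fin l) (k : ℤ) : Module.End ℂ (BFock l) :=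
  if k ≤ 0 then LinearMap.mulLeft ℂ (MvPolynomial.X ((ε, p, (-k).toNat) : BBas l))
  else (if ε then (1 : ℂ) else -1) •
    (MvPolynomial.pderiv ((!ε, p, (k - 1).toNat) : BBas l)).toLinearMap

theorem bosonEnd_apply (l : ℕ) (ε : Bool) (p : Fin l) (k : ℤ) (x : BFock l) :
    bosonEnd l ε p k x = boson l ε p k x := by
  unfold bosonEnd boson gamCr gamAn
  split_ifs <;> simp_all

theorem bosonEnd_of_nonpos {l : ℕ} (ε : Bool) (p : Fin l) {k : ℤ} (hk : k ≤ 0) (x : BFock l) :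
    bosonEnd l ε p k x = MvPolynomial.X (ε, p, (-k).toNat) * x := by
  simp [bosonEnd, hk]

theorem bosonEnd_of_pos {l : ℕ} (ε : Bool) (p : Fin l) {k : ℤ} (hk : 0 < k) (x : BFock l) :
    bosonEnd l ε p k x =
      (if ε then (1 : ℂ) else -1) • MvPolynomial.pderiv (!ε, p, (k - 1).toNat) x := by
  rw [bosonEnd, if_neg hk.not_ge]
  rfl

theorem pderiv_pderiv_comm {σ R : Type*} [CommRing R] (a b : σ) (x : MvPolynomial σ R) :
    MvPolynomial.pderiv a (MvPolynomial.pderiv b x) =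
      MvPolynomial.pderiv b (MvPolynomial.pderiv a x) := by
  classical
  have h : ⁅MvPolynomial.pderiv (R := R) a, MvPolynomial.pderiv b⁆ = 0 :=
    MvPolynomial.derivation_ext fun c => by
      rw [Derivation.commutator_apply]
      simp only [MvPolynomial.pderiv_X, Pi.single_apply]
      split_ifs <;> simp
  have := DFunLike.congr_fun h x
  rwa [Derivation.commutator_apply, Derivation.zero_apply, sub_eq_zero] at this

/-- The commutator of two modes, which is a scalar. -/
def bosonBracket {l : ℕ} (ε : Bool) (p : Fin l) (k : ℤ) (ε' : Bool) (q : Fin l) (m : ℤ) : ℂ :=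
  if ε ≠ ε' ∧ p = q ∧ k + m = 1 then (if ε then 1 else -1) else 0

theorem bosonEnd_comm (l : ℕ) (ε : Bool) (p : Fin l) (k : ℤ) (ε' : Bool) (q : Fin l) (m : ℤ) :
    bosonEnd l ε p k * bosonEnd l ε' q m =
      bosonEnd l ε' q m * bosonEnd l ε p k + bosonBracket ε p k ε' q m • 1 := by
  refine LinearMap.ext fun x => ?_
  simp only [Module.End.mul_apply, LinearMap.add_apply, LinearMap.smul_apply, Module.End.one_apply]
  unfold bosonBracket
  by_cases hk : k ≤ 0 <;> by_cases hm : m ≤ 0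
  · have h : ¬ k + m = 1 := by omega
    simp only [bosonEnd_of_nonpos _ _ hk, bosonEnd_of_nonpos _ _ hm, h, and_false, if_false,
      zero_smul, add_zero]
    ring
  · have index_iff : (-k).toNat = (m - 1).toNat ↔ k + m = 1 := by omega
    simp only [bosonEnd_of_nonpos _ _ hk, bosonEnd_of_pos _ _ (not_le.1 hm),
      MvPolynomial.pderiv_mul, MvPolynomial.pderiv_X, Pi.single_apply, Prod.mk.injEq, index_iff]
    by_cases h : k + m = 1 <;> by_cases hpq : p = q <;> cases ε <;> cases ε' <;>
      simp [h, hpq, add_comm]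
  · have index_iff : (-m).toNat = (k - 1).toNat ↔ k + m = 1 := by omega
    simp only [bosonEnd_of_nonpos _ _ hm, bosonEnd_of_pos _ _ (not_le.1 hk),
      MvPolynomial.pderiv_mul, MvPolynomial.pderiv_X, Pi.single_apply, Prod.mk.injEq, index_iff,
      eq_comm (a := q)]
    by_cases h : k + m = 1 <;> by_cases hpq : p = q <;> cases ε <;> cases ε' <;>
      simp [h, hpq, add_comm]
  · have h : ¬ k + m = 1 := by omega
    simp only [bosonEnd_of_pos _ _ (not_le.1 hk), bosonEnd_of_pos _ _ (not_le.1 hm), h, and_false,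
      if_false, zero_smul, add_zero, Derivation.map_smul]
    rw [smul_comm, pderiv_pderiv_comm]

/-- The normally ordered product as a linear endomorphism of the Fock space. -/
def nGamEnd (l : ℕ) (ε₁ : Bool) (p₁ : Fin l) (k₁ : ℤ) (ε₂ : Bool) (p₂ : Fin l) (k₂ : ℤ) :
    Module.End ℂ (BFock l) :=
  if 1 ≤ k₁ ∧ k₂ ≤ 0 then bosonEnd l ε₂ p₂ k₂ * bosonEnd l ε₁ p₁ k₁
  else bosonEnd l ε₁ p₁ k₁ * bosonEnd l ε₂ p₂ k₂

theorem nGamEnd_apply (l : ℕ) (ε₁ : Bool) (p₁ : Fin l) (k₁ : ℤ) (ε₂ : Bool) (p₂ : Fin l) (k₂ : ℤ)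
    (x : BFock l) : nGamEnd l ε₁ p₁ k₁ ε₂ p₂ k₂ x = nGam l ε₁ p₁ k₁ ε₂ p₂ k₂ x := by
  unfold nGamEnd nGam
  split_ifs <;> simp [bosonEnd_apply]

/-- Normal ordering changes a product of two modes by a scalar only. -/
theorem exists_nGamEnd_eq (l : ℕ) (ε₁ : Bool) (p₁ : Fin l) (k₁ : ℤ) (ε₂ : Bool) (p₂ : Fin l)
    (k₂ : ℤ) : ∃ c : ℂ, nGamEnd l ε₁ p₁ k₁ ε₂ p₂ k₂ =
      bosonEnd l ε₁ p₁ k₁ * bosonEnd l ε₂ p₂ k₂ + c • 1 := by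
  unfold nGamEnd
  split_ifs
  · exact ⟨_, bosonEnd_comm ..⟩
  · exact ⟨0, by simp⟩

theorem bosonEnd_apply_eq_zero (l : ℕ) (ε : Bool) (p : Fin l) (k : ℤ) (x : BFock l)
    (hk : ((x.vars.sup fun v => v.2.2 : ℕ) : ℤ) + 1 < k) : bosonEnd l ε p k x = 0 := by
  have : ((!ε, p, (k - 1).toNat) : BBas l) ∉ x.vars := fun h => by
    have := Finset.le_sup (f := fun v : BBas l => v.2.2) h
    simp only at this
    omega
  rw [bosonEnd_of_pos _ _ (by omega), MvPolynomial.pderiv_eq_zero_of_notMem_vars this, smul_zero]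

theorem finite_support_nGamEnd (l : ℕ) (ε₁ : Bool) (p : Fin l) (ε₂ : Bool) (q : Fin l)
    (x : BFock l) :
    (Function.support fun k : ℤ => nGamEnd l ε₁ p (1 - k) ε₂ q k x).Finite := by
  set N : ℤ := ((x.vars.sup fun v => v.2.2 : ℕ) : ℤ)
  refine (Set.finite_Icc (-N) (N + 1)).subset fun k hk => ?_
  by_contra hmem
  refine hk ?_
  change nGamEnd l ε₁ p (1 - k) ε₂ q k x = 0
  rw [Set.mem_Icc, not_and_or] at hmem
  unfold nGamEnd
  split_ifs with h
  · rw [Module.End.mul_apply, bosonEnd_apply_eq_zero l ε₁ p (1 - k) x (by omega), map_zero]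
  · rw [Module.End.mul_apply, bosonEnd_apply_eq_zero l ε₂ q k x (by omega), map_zero]

/-- `Ê_{ij}` as a linear endomorphism of the Fock space. -/
def bEhatEnd (l : ℕ) (i j : ℤ) : Module.End ℂ (BFock l) :=
  (-1 : ℂ) • ∑ p : Fin l, nGamEnd l true p (1 - i) false p j

theorem bEhatEnd_apply (l : ℕ) (i j : ℤ) (x : BFock l) : bEhatEnd l i j x = bEhat l i j x := by
  simp [bEhatEnd, bEhat, nGamEnd_apply]

theorem comm_eq_of_eq_mul_add {R : Type*} [Ring R] [Algebra ℂ R] (a b c n : R) (z : ℂ)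
    (h : n = b * c + z • 1) :
    a * n - n * a = (a * b - b * a) * c + b * (a * c - c * a) := by
  rw [h, mul_add, add_mul, mul_smul_comm, smul_mul_assoc, mul_one, one_mul]
  noncomm_ring

theorem comm_eq_of_comm_eq_smul_one {R : Type*} [Ring R] [Algebra ℂ R] (a b c n : R)
    (z s t : ℂ) (h : n = b * c + z • 1) (hb : b * a = a * b + s • 1) (hc : c * a = a * c + t • 1) :
    n * a - a * n = s • c + t • b := by
  rw [h, add_mul, mul_assoc, hc, mul_add, ← mul_assoc, hb]
  simp only [add_mul, mul_add, smul_mul_assoc, mul_smul_comm, one_mul, mul_one, mul_assoc]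
  abel

theorem neg_one_smul_sum_comm {R ι : Type*} [Ring R] [Algebra ℂ R] (s : Finset ι) (f : ι → R)
    (a : R) : ((-1 : ℂ) • ∑ p ∈ s, f p) * a - a * ((-1 : ℂ) • ∑ p ∈ s, f p) =
      (-1 : ℂ) • ∑ p ∈ s, (f p * a - a * f p) := by
  rw [smul_mul_assoc, mul_smul_comm, Finset.sum_mul, Finset.mul_sum, Finset.sum_sub_distrib,
    smul_sub]

theorem mul_smul_sub_smul_mul {R : Type*} [Ring R] [Algebra ℂ R] (a b : R) (s : ℂ) :
    a * (s • b) - (s • b) * a = s • (a * b - b * a) := by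
  rw [smul_mul_assoc, mul_smul_comm, smul_sub]

theorem comm_nGamEnd (l : ℕ) (A : Module.End ℂ (BFock l)) (ε₁ : Bool) (p₁ : Fin l) (k₁ : ℤ)
    (ε₂ : Bool) (p₂ : Fin l) (k₂ : ℤ) :
    A * nGamEnd l ε₁ p₁ k₁ ε₂ p₂ k₂ - nGamEnd l ε₁ p₁ k₁ ε₂ p₂ k₂ * A =
      (A * bosonEnd l ε₁ p₁ k₁ - bosonEnd l ε₁ p₁ k₁ * A) * bosonEnd l ε₂ p₂ k₂ +
        bosonEnd l ε₁ p₁ k₁ * (A * bosonEnd l ε₂ p₂ k₂ - bosonEnd l ε₂ p₂ k₂ * A) := by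
  obtain ⟨c, hc⟩ := exists_nGamEnd_eq l ε₁ p₁ k₁ ε₂ p₂ k₂
  exact comm_eq_of_eq_mul_add _ _ _ _ c hc

theorem nGamEnd_comm_bosonEnd (l : ℕ) (ε₁ : Bool) (p₁ : Fin l) (k₁ : ℤ) (ε₂ : Bool) (p₂ : Fin l)
    (k₂ : ℤ) (ε : Bool) (q : Fin l) (k : ℤ) :
    nGamEnd l ε₁ p₁ k₁ ε₂ p₂ k₂ * bosonEnd l ε q k -
        bosonEnd l ε q k * nGamEnd l ε₁ p₁ k₁ ε₂ p₂ k₂ =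
      bosonBracket ε₁ p₁ k₁ ε q k • bosonEnd l ε₂ p₂ k₂ +
        bosonBracket ε₂ p₂ k₂ ε q k • bosonEnd l ε₁ p₁ k₁ := by
  obtain ⟨c, hc⟩ := exists_nGamEnd_eq l ε₁ p₁ k₁ ε₂ p₂ k₂
  exact comm_eq_of_comm_eq_smul_one _ _ _ _ c _ _ hc (bosonEnd_comm ..) (bosonEnd_comm ..)

theorem bEhatEnd_comm_true (l : ℕ) (i j : ℤ) (q : Fin l) (k : ℤ) :
    bEhatEnd l i j * bosonEnd l true q k - bosonEnd l true q k * bEhatEnd l i j =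
      if k = 1 - j then bosonEnd l true q (1 - i) else 0 := by
  have h : j + k = 1 ↔ k = 1 - j := by omega
  refine (neg_one_smul_sum_comm Finset.univ (fun p => nGamEnd l true p (1 - i) false p j)
    (bosonEnd l true q k)).trans ?_
  simp only [nGamEnd_comm_bosonEnd, bosonBracket, h]
  by_cases hk : k = 1 - j <;> simp [hk, ite_smul, smul_smul, -neg_smul]

theorem bEhatEnd_comm_false (l : ℕ) (i j : ℤ) (q : Fin l) (k : ℤ) :
    bEhatEnd l i j * bosonEnd l false q k - bosonEnd l false q k * bEhatEnd l i j =
      if k = i then (-1 : ℂ) • bosonEnd l false q j else 0 := by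
  have h : 1 - i + k = 1 ↔ k = i := by omega
  refine (neg_one_smul_sum_comm Finset.univ (fun p => nGamEnd l true p (1 - i) false p j)
    (bosonEnd l false q k)).trans ?_
  simp only [nGamEnd_comm_bosonEnd, bosonBracket, h]
  by_cases hk : k = i <;> simp [hk, ite_smul, -neg_smul]

/-- The commutator of an operator with a locally finite sum, when only two summands contribute. -/
theorem apply_finsum_sub_finsum_apply {M : Type*} [AddCommGroup M] [Module ℂ M]
    (A : Module.End ℂ M) (T : ℤ → Module.End ℂ M)
    (hT : ∀ x, (Function.support fun k => T k x).Finite) (u v : ℤ) (U V : Module.End ℂ M)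
    (h : ∀ k, A * T k - T k * A = (if k = u then U else 0) + (if k = v then V else 0)) (x : M) :
    A (∑ᶠ k, T k x) - ∑ᶠ k, T k (A x) = U x + V x := by
  classical
  set S : Finset ℤ := (hT x).toFinset ∪ (hT (A x)).toFinset ∪ {u, v} with hS
  rw [finsum_eq_sum_of_support_subset (s := S) _ fun k hk => by simp_all,
    finsum_eq_sum_of_support_subset (s := S) _ fun k hk => by simp_all,
    map_sum, ← Finset.sum_sub_distrib]
  have hk (k : ℤ) : A (T k x) - T k (A x) =
      (if k = u then U x else 0) + (if k = v then V x else 0) := by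
    have := LinearMap.congr_fun (h k) x
    simp only [LinearMap.sub_apply, Module.End.mul_apply, LinearMap.add_apply] at this
    rw [this]
    split_ifs <;> rfl
  have hu : u ∈ S := by simp [hS]
  have hv : v ∈ S := by simp [hS]
  simp [hk, Finset.sum_add_distrib, hu, hv]

theorem bEhatEnd_bestar (l : ℕ) (i j : ℤ) (p q : Fin l) (x : BFock l) :
    bEhatEnd l i j (bestar l p q x) = bestar l p q (bEhatEnd l i j x) := by
  have := apply_finsum_sub_finsum_apply (bEhatEnd l i j)
    (fun k => nGamEnd l true p (1 - k) false q k) (finite_support_nGamEnd l true p false q) j i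
    (bosonEnd l true p (1 - i) * bosonEnd l false q j)
    ((-1 : ℂ) • (bosonEnd l true p (1 - i) * bosonEnd l false q j)) (fun k => by
      rw [comm_nGamEnd, bEhatEnd_comm_true, bEhatEnd_comm_false]
      have h : 1 - k = 1 - j ↔ k = j := by omega
      simp only [h]
      congr 1 <;> split_ifs with hk <;> simp [hk, -neg_smul]) x
  simp only [nGamEnd_apply, LinearMap.smul_apply, neg_one_smul, add_neg_cancel] at this
  exact sub_eq_zero.1 this

theorem finite_support_smul_nGamEnd (l : ℕ) (ε₁ : Bool) (p : Fin l) (ε₂ : Bool) (q : Fin l)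
    (a : ℤ → ℂ) (x : BFock l) :
    (Function.support fun k : ℤ => (a k • nGamEnd l ε₁ p (1 - k) ε₂ q k) x).Finite := by
  refine (finite_support_nGamEnd l ε₁ p ε₂ q x).subset fun k hk h => hk ?_
  simp only [LinearMap.smul_apply] at h ⊢
  rw [h, smul_zero]

theorem neg_one_zpow_one_sub (i : ℤ) : (-1 : ℂ) ^ (1 - i) = -(-1 : ℂ) ^ i := by
  rcases Int.even_or_odd i with h | h
  · rw [h.neg_one_zpow, (odd_one.sub_even h).neg_one_zpow]
  · rw [h.neg_one_zpow, (odd_one.sub_odd h).neg_one_zpow, neg_neg]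

theorem bEhatEnd_beeTw (l : ℕ) (i j : ℤ) (p q : Fin l) (x : BFock l) :
    bEhatEnd l i j (beeTw l p q x) - beeTw l p q (bEhatEnd l i j x) =
      (-1 : ℂ) ^ i • ((bosonEnd l false p j * bosonEnd l false q (1 - i)) x -
        (bosonEnd l false p (1 - i) * bosonEnd l false q j) x) := by
  have := apply_finsum_sub_finsum_apply (bEhatEnd l i j)
    (fun k => (-1 : ℂ) ^ k • nGamEnd l false p (1 - k) false q k)
    (finite_support_smul_nGamEnd l false p false q _) (1 - i) i
    ((-1 : ℂ) ^ (1 - i) • (-1 : ℂ) • (bosonEnd l false p j * bosonEnd l false q (1 - i)))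
    ((-1 : ℂ) ^ i • (-1 : ℂ) • (bosonEnd l false p (1 - i) * bosonEnd l false q j)) (fun k => by
      refine (mul_smul_sub_smul_mul _ _ _).trans ?_
      rw [comm_nGamEnd, bEhatEnd_comm_false, bEhatEnd_comm_false, smul_add]
      have h : 1 - k = i ↔ k = 1 - i := by omega
      simp only [h]
      congr 1 <;> split_ifs with hk <;> simp [hk, -neg_smul]) x
  simp only [LinearMap.smul_apply, nGamEnd_apply] at this
  refine this.trans ?_
  rw [neg_one_zpow_one_sub]
  module

theorem bEhatEnd_bestarstarTw (l : ℕ) (i j : ℤ) (p q : Fin l) (x : BFock l) :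
    bEhatEnd l i j (bestarstarTw l p q x) - bestarstarTw l p q (bEhatEnd l i j x) =
      (-1 : ℂ) ^ j • ((bosonEnd l true p (1 - i) * bosonEnd l true q j) x -
        (bosonEnd l true p j * bosonEnd l true q (1 - i)) x) := by
  have := apply_finsum_sub_finsum_apply (bEhatEnd l i j)
    (fun k => (-1 : ℂ) ^ k • nGamEnd l true p (1 - k) true q k)
    (finite_support_smul_nGamEnd l true p true q _) j (1 - j)
    ((-1 : ℂ) ^ j • (bosonEnd l true p (1 - i) * bosonEnd l true q j))
    ((-1 : ℂ) ^ (1 - j) • (bosonEnd l true p j * bosonEnd l true q (1 - i))) (fun k => by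
      refine (mul_smul_sub_smul_mul _ _ _).trans ?_
      rw [comm_nGamEnd, bEhatEnd_comm_true, bEhatEnd_comm_true, smul_add]
      have h : 1 - k = 1 - j ↔ k = j := by omega
      simp only [h]
      congr 1 <;> split_ifs with hk <;> simp [hk, -neg_smul]) x
  simp only [LinearMap.smul_apply, nGamEnd_apply] at this
  refine this.trans ?_
  rw [neg_one_zpow_one_sub]
  module

theorem finsum_apply_sub_smul {M : Type*} [AddCommGroup M] [Module ℂ M]
    (T : ℤ → Module.End ℂ M) (hT : ∀ x, (Function.support fun k => T k x).Finite) (s : ℂ)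
    (x y : M) : ∑ᶠ k, T k (x - s • y) = ∑ᶠ k, T k x - s • ∑ᶠ k, T k y := by
  rw [smul_finsum, ← finsum_sub_distrib (hT x)]
  · simp
  · exact (hT (s • y)).subset fun k hk => by simpa using hk

theorem commutes_of_sub_eq {M : Type*} [AddCommGroup M] [Module ℂ M]
    (A B : Module.End ℂ M) (T : ℤ → Module.End ℂ M)
    (hT : ∀ x, (Function.support fun k => T k x).Finite) (s : ℂ) (x : M)
    (h : A (∑ᶠ k, T k x) - ∑ᶠ k, T k (A x) = s • (B (∑ᶠ k, T k x) - ∑ᶠ k, T k (B x))) :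
    A (∑ᶠ k, T k x) - s • B (∑ᶠ k, T k x) = ∑ᶠ k, T k (A x - s • B x) := by
  rw [finsum_apply_sub_smul T hT, ← sub_eq_zero]
  rw [smul_sub, ← sub_eq_zero] at h
  rw [← h]
  abel

/-- for all `i, j ∈ ℤ` and all `1 ≤ p, q ≤ l`, the operator
`Ĉ_{ij} = Ê_{ij} - (-1)^{i+j} Ê_{1-j,1-i}` commutes with `ê*^{pq}`, with `ẽ^{pq}` and
with `ẽ**^{pq}`. -/
theorem bChat_comm_twisted (l : ℕ) (hl : 1 ≤ l) (i j : ℤ) (p q : Fin l) (x : BFock l) :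
    bChat l i j (bestar l p q x) = bestar l p q (bChat l i j x) ∧
    bChat l i j (beeTw l p q x) = beeTw l p q (bChat l i j x) ∧
    bChat l i j (bestarstarTw l p q x) = bestarstarTw l p q (bChat l i j x) := by
  have hneg (a : ℤ) : (-1 : ℂ) ^ a * (-1 : ℂ) ^ a = 1 := by
    rw [← mul_zpow]; simp
  simp only [bChat, ← bEhatEnd_apply]
  refine ⟨?_, ?_, ?_⟩
  · have := commutes_of_sub_eq (bEhatEnd l i j) (bEhatEnd l (1 - j) (1 - i))
      (fun k => nGamEnd l true p (1 - k) false q k) (finite_support_nGamEnd l true p false q)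
      ((-1) ^ (i + j)) x
    simp only [nGamEnd_apply] at this
    refine this ?_
    have h₁ := bEhatEnd_bestar l i j p q x
    have h₂ := bEhatEnd_bestar l (1 - j) (1 - i) p q x
    unfold bestar at h₁ h₂
    rw [h₁, h₂, sub_self, sub_self, smul_zero]
  · have := commutes_of_sub_eq (bEhatEnd l i j) (bEhatEnd l (1 - j) (1 - i))
      (fun k => (-1 : ℂ) ^ k • nGamEnd l false p (1 - k) false q k)
      (finite_support_smul_nGamEnd l false p false q _) ((-1) ^ (i + j)) x
    simp only [LinearMap.smul_apply, nGamEnd_apply] at this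
    refine this ?_
    have h₁ := bEhatEnd_beeTw l i j p q x
    have h₂ := bEhatEnd_beeTw l (1 - j) (1 - i) p q x
    unfold beeTw at h₁ h₂
    rw [h₁, h₂, smul_smul, neg_one_zpow_one_sub, zpow_add₀ (by norm_num), mul_neg, mul_assoc,
      hneg, sub_sub_cancel]
    module
  · have := commutes_of_sub_eq (bEhatEnd l i j) (bEhatEnd l (1 - j) (1 - i))
      (fun k => (-1 : ℂ) ^ k • nGamEnd l true p (1 - k) true q k)
      (finite_support_smul_nGamEnd l true p true q _) ((-1) ^ (i + j)) x
    simp only [LinearMap.smul_apply, nGamEnd_apply] at this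
    refine this ?_
    have h₁ := bEhatEnd_bestarstarTw l i j p q x
    have h₂ := bEhatEnd_bestarstarTw l (1 - j) (1 - i) p q x
    unfold bestarstarTw at h₁ h₂
    rw [h₁, h₂, smul_smul, neg_one_zpow_one_sub, zpow_add₀ (by norm_num), mul_neg, mul_right_comm,
      hneg, sub_sub_cancel]
    module

end
end
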